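/- arXiv:math/0301193 — 4 statements merged into one kernel-verified Lean document; each statement's English description precedes it below -/
import Mathlib

section
/- Let (λ_n)_{n≥1} and (μ_n)_{n≥1} be sequences of positive real numbers such that: (1) the sequences (λ_n²) and (μ_n²) consist of pairwise distinct numbers and interlace (i.e., either λ_n² < μ_n² < λ_{n+1}² for all n, or μ_n² < λ_n² < μ_{n+1}² for all n); (2) λ_n = π(n−1/2) + λ̃_n and μ_n = π(n−1/2) + μ̃_n with ℓ²-sequences (λ̃_n) and (μ̃_n); (3) there exist a nonzero real number h and an ℓ²-sequence (ν_n) such that λ_n − μ_n = h/(πn) + ν_n/n for all n. Define Φ₁(λ) := ∏_{k=1}^∞ (λ_k² − λ²)/(π²(k−1/2)²) and Φ₂(λ) := ∏_{k=1}^∞ (μ_k² − λ²)/(π²(k−1/2)²) for λ ∈ ℂ. Then Φ₁ is entire, Φ₂(λ_n) ≠ 0 for every n, the numbers α_n := (h/λ_n)·Φ₁′(λ_n)/Φ₂(λ_n) are real and positive for all n, and (α_n − 1)_{n≥1} is an ℓ²-sequence. -/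
open MeasureTheory Filter Real Set
open scoped Topology

namespace NC

/-- The quotient factor in the product. -/
noncomputable def fac (x : ℕ → ℝ) (k : ℕ) (z : ℂ) : ℂ :=
  (((x k : ℝ) : ℂ) ^ 2 - z ^ 2) / ((π : ℂ) ^ 2 * ((k : ℂ) + 1 / 2) ^ 2)

/-- Real version. -/
noncomputable def rfac (x : ℕ → ℝ) (k : ℕ) (t : ℝ) : ℝ :=
  (x k ^ 2 - t ^ 2) / (π ^ 2 * ((k : ℝ) + 1 / 2) ^ 2)

lemma fac_ofReal (x : ℕ → ℝ) (k : ℕ) (t : ℝ) : fac x k (t : ℂ) = ((rfac x k t : ℝ) : ℂ) := by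
  simp [fac, rfac]

lemma one_le_p (k : ℕ) : 1 ≤ π * ((k : ℝ) + 1 / 2) := by
  have := Real.pi_gt_three
  have hk : (0 : ℝ) ≤ k := Nat.cast_nonneg k
  nlinarith

lemma summable_inv_p : Summable (fun k : ℕ => 1 / (π * ((k : ℝ) + 1 / 2)) ^ 2) := by
  have h1 : Summable (fun k : ℕ => 1 / |(k : ℝ) + 1 / 2| ^ (2 : ℝ)) :=
    (Real.summable_one_div_nat_add_rpow (1 / 2) 2).2 (by norm_num)
  refine Summable.of_nonneg_of_le (fun k => by positivity) (fun k => ?_) h1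
  have hk : (0 : ℝ) ≤ k := Nat.cast_nonneg k
  rw [abs_of_pos (by positivity), Real.rpow_two]
  have := Real.pi_gt_three
  have h2 : (k : ℝ) + 1 / 2 ≤ π * ((k : ℝ) + 1 / 2) := by nlinarith
  gcongr

lemma fac_bound (x : ℕ → ℝ) (hx : Summable (fun n : ℕ => (x n - π * ((n : ℝ) + 1 / 2)) ^ 2))
    (R : ℝ) : ∃ u : ℕ → ℝ, Summable u ∧ ∀ k z, ‖z‖ ≤ R → ‖fac x k z - 1‖ ≤ u k := by
  refine ⟨fun k => 2 * (x k - π * ((k : ℝ) + 1 / 2)) ^ 2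
    + (1 + R ^ 2) * (1 / (π * ((k : ℝ) + 1 / 2)) ^ 2),
    (hx.mul_left 2).add (summable_inv_p.mul_left _), fun k z hz => ?_⟩
  set p : ℝ := π * ((k : ℝ) + 1 / 2) with hp
  have hp1 : 1 ≤ p := one_le_p k
  have hp0 : p ≠ 0 := by positivity
  set t := x k - p with ht
  have hpc : (p : ℂ) ≠ 0 := by exact_mod_cast hp0
  have e1 : (π : ℂ) ^ 2 * ((k : ℂ) + 1 / 2) ^ 2 = (p : ℂ) ^ 2 := by
    rw [hp]; push_cast; ring
  have e2 : fac x k z - 1 = (((t / p) ^ 2 + 2 * (t / p) : ℝ) : ℂ) - z ^ 2 / (p : ℂ) ^ 2 := by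
    rw [fac, e1]
    have : x k = t + p := by rw [ht]; ring
    rw [this]
    push_cast
    field_simp
    ring
  rw [e2]
  have n1 : ‖z ^ 2 / (p : ℂ) ^ 2‖ ≤ R ^ 2 * (1 / p ^ 2) := by
    rw [norm_div, norm_pow, norm_pow, Complex.norm_real, Real.norm_eq_abs, sq_abs, mul_one_div]
    gcongr
  have n2 : ‖(((t / p) ^ 2 + 2 * (t / p) : ℝ) : ℂ)‖ ≤ 2 * t ^ 2 + 1 / p ^ 2 := by
    rw [Complex.norm_real, Real.norm_eq_abs]
    have i1 : (1 / p) ^ 2 ≤ 1 := by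
      have : 1 / p ≤ 1 := by rw [div_le_one (by positivity)]; exact hp1
      have : 0 ≤ 1 / p := by positivity
      nlinarith
    have i2 : t / p = t * (1 / p) := by ring
    have i3 : 1 / p ^ 2 = (1 / p) ^ 2 := by rw [one_div_pow]
    rw [i2, i3]
    rw [abs_le]
    constructor
    · nlinarith [sq_nonneg (t + 1 / p), sq_nonneg (t * (1 / p)), sq_nonneg t]
    · nlinarith [sq_nonneg (t - 1 / p), mul_le_mul_of_nonneg_left i1 (sq_nonneg t)]
  calc _ ≤ _ := norm_sub_le _ _
    _ ≤ 2 * t ^ 2 + (1 + R ^ 2) * (1 / p ^ 2) := by linarith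

lemma rfac_summable (x : ℕ → ℝ)
    (hx : Summable (fun n : ℕ => (x n - π * ((n : ℝ) + 1 / 2)) ^ 2)) (t : ℝ) :
    Summable (fun k => ‖rfac x k t - 1‖) := by
  obtain ⟨u, hu, hb⟩ := fac_bound x hx ‖(t : ℂ)‖
  refine Summable.of_nonneg_of_le (fun k => norm_nonneg _) (fun k => ?_) hu
  have := hb k (t : ℂ) le_rfl
  rw [fac_ofReal] at this
  rw [← Complex.norm_real]
  simpa using this

/-- nonzero limit of the reduced product -/
lemma exists_limit (x : ℕ → ℝ)
    (hx : Summable (fun n : ℕ => (x n - π * ((n : ℝ) + 1 / 2)) ^ 2)) (t : ℝ) (n : ℕ)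
    (hne : ∀ k, k ≠ n → x k ^ 2 ≠ t ^ 2) :
    ∃ L : ℝ, L ≠ 0 ∧ Tendsto (fun N => ∏ k ∈ Finset.range N, if k = n then 1 else rfac x k t)
      atTop (𝓝 L) := by
  set f : ℕ → ℝ := fun k => (if k = n then 1 else rfac x k t) - 1 with hf
  have hs : Summable (fun k => ‖f k‖) := by
    refine Summable.of_nonneg_of_le (fun k => norm_nonneg _) (fun k => ?_) (rfac_summable x hx t)
    by_cases hk : k = n
    · simp [hf, hk]
    · simp [hf, hk]
  have hf1 : ∀ k, 1 + f k = if k = n then 1 else rfac x k t := fun k => by simp [hf]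
  refine ⟨∏' k, (1 + f k), tprod_one_add_ne_zero_of_summable (fun k => ?_) hs, ?_⟩
  · rw [hf1]
    split_ifs with hk
    · exact one_ne_zero
    · rw [rfac]
      have := Real.pi_pos
      have : x k ^ 2 - t ^ 2 ≠ 0 := sub_ne_zero.2 (hne k hk)
      positivity
  · have := (multipliable_one_add_of_summable hs).tendsto_prod_tprod_nat
    simpa only [hf1] using this

lemma prod_split {M : Type*} [CommMonoid M] (g : ℕ → M) (n N : ℕ) (hN : n < N) :
    ∏ k ∈ Finset.range N, g k
      = g n * ∏ k ∈ Finset.range N, (if k = n then 1 else g k) := by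
  have hm : n ∈ Finset.range N := Finset.mem_range.2 hN
  rw [← Finset.mul_prod_erase _ g hm, ← Finset.mul_prod_erase _ (fun k => if k = n then 1 else g k) hm]
  simp only [if_true, one_mul]
  congr 1
  refine Finset.prod_congr rfl fun k hk => ?_
  rw [if_neg (Finset.ne_of_mem_erase hk)]

lemma loc_unif (x : ℕ → ℝ) (hx : Summable (fun n : ℕ => (x n - π * ((n : ℝ) + 1 / 2)) ^ 2))
    (Φ : ℂ → ℂ)
    (hΦ : ∀ z : ℂ, Tendsto (fun N : ℕ => ∏ k ∈ Finset.range N, fac x k z) atTop (𝓝 (Φ z))) :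
    TendstoLocallyUniformlyOn (fun (N : ℕ) (z : ℂ) => ∏ k ∈ Finset.range N, fac x k z) Φ atTop
      univ := by
  rw [tendstoLocallyUniformlyOn_iff_forall_isCompact isOpen_univ]
  intro K _ hK
  obtain ⟨R, hR⟩ := hK.isBounded.exists_norm_le
  obtain ⟨u, hu, hb⟩ := fac_bound x hx R
  have h1 := hu.hasProdUniformlyOn_nat_one_add (f := fun k z => fac x k z - 1) hK
    (Eventually.of_forall fun k z hz => hb k z (hR z hz))
    (fun k => by unfold fac; fun_prop)
  have h2 := h1.tendstoUniformlyOn_finsetRange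
  simp only [add_sub_cancel] at h2
  refine h2.congr_right fun z hz => ?_
  exact tendsto_nhds_unique (h2.tendsto_at hz) (hΦ z)

lemma fac_diff (x : ℕ → ℝ) (k : ℕ) : Differentiable ℂ (fac x k) := by
  unfold fac; fun_prop

lemma phi_diff (x : ℕ → ℝ) (hx : Summable (fun n : ℕ => (x n - π * ((n : ℝ) + 1 / 2)) ^ 2))
    (Φ : ℂ → ℂ)
    (hΦ : ∀ z : ℂ, Tendsto (fun N : ℕ => ∏ k ∈ Finset.range N, fac x k z) atTop (𝓝 (Φ z))) :
    Differentiable ℂ Φ := by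
  rw [← differentiableOn_univ]
  refine (loc_unif x hx Φ hΦ).differentiableOn (Eventually.of_forall fun N => ?_) isOpen_univ
  rw [differentiableOn_univ]
  exact Differentiable.fun_finsetProd fun k _ => fac_diff x k

lemma phi_deriv (x : ℕ → ℝ) (hx : Summable (fun n : ℕ => (x n - π * ((n : ℝ) + 1 / 2)) ^ 2))
    (Φ : ℂ → ℂ)
    (hΦ : ∀ z : ℂ, Tendsto (fun N : ℕ => ∏ k ∈ Finset.range N, fac x k z) atTop (𝓝 (Φ z)))
    (n : ℕ) (L : ℝ)
    (hL : Tendsto (fun N => ∏ k ∈ Finset.range N, if k = n then 1 else rfac x k (x n))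
      atTop (𝓝 L)) :
    deriv Φ ((x n : ℝ) : ℂ) = ((-2 * x n / (π ^ 2 * ((n : ℝ) + 1 / 2) ^ 2) * L : ℝ) : ℂ) := by
  have h1 := ((loc_unif x hx Φ hΦ).deriv (Eventually.of_forall fun N => by
    rw [differentiableOn_univ]
    exact Differentiable.fun_finsetProd fun k _ => fac_diff x k) isOpen_univ).tendsto_at
    (mem_univ ((x n : ℝ) : ℂ))
  refine tendsto_nhds_unique h1 ?_
  have h2 : Tendsto (fun N => ((-2 * x n / (π ^ 2 * ((n : ℝ) + 1 / 2) ^ 2) *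
    ∏ k ∈ Finset.range N, (if k = n then 1 else rfac x k (x n)) : ℝ) : ℂ)) atTop
    (𝓝 ((-2 * x n / (π ^ 2 * ((n : ℝ) + 1 / 2) ^ 2) * L : ℝ) : ℂ)) :=
    (Complex.continuous_ofReal.tendsto _).comp (hL.const_mul _)
  refine h2.congr' ?_
  filter_upwards [eventually_gt_atTop n] with N hN
  simp only [Function.comp]
  have e : (fun z : ℂ => ∏ k ∈ Finset.range N, fac x k z) = fun z =>
      fac x n z * ∏ k ∈ Finset.range N, (if k = n then 1 else fac x k z) := by
    funext z; exact prod_split (fun k => fac x k z) n N hN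
  rw [e]
  have d1 : HasDerivAt (fac x n) (-(2 * (x n : ℂ)) / ((π : ℂ) ^ 2 * ((n : ℂ) + 1 / 2) ^ 2))
      ((x n : ℝ) : ℂ) := by
    unfold fac
    have := ((hasDerivAt_pow 2 ((x n : ℝ) : ℂ)).const_sub (((x n : ℝ) : ℂ) ^ 2)).div_const
      ((π : ℂ) ^ 2 * ((n : ℂ) + 1 / 2) ^ 2)
    simpa using this
  have d2 : DifferentiableAt ℂ
      (fun z : ℂ => ∏ k ∈ Finset.range N, (if k = n then 1 else fac x k z)) ((x n : ℝ) : ℂ) := by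
    refine DifferentiableAt.fun_finsetProd fun k _ => ?_
    split_ifs
    · fun_prop
    · exact (fac_diff x k).differentiableAt
  have d3 := (d1.mul d2.hasDerivAt).deriv
  have z0 : fac x n ((x n : ℝ) : ℂ) = 0 := by simp [fac]
  rw [z0, zero_mul, add_zero] at d3
  refine Eq.trans ?_ d3.symm
  push_cast
  congr 1
  · ring
  · refine Finset.prod_congr rfl fun k _ => ?_
    rw [fac_ofReal]
    split_ifs <;> simp

lemma phi_val (x : ℕ → ℝ) (Φ : ℂ → ℂ)
    (hΦ : ∀ z : ℂ, Tendsto (fun N : ℕ => ∏ k ∈ Finset.range N, fac x k z) atTop (𝓝 (Φ z)))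
    (t : ℝ) (n : ℕ) (L : ℝ)
    (hL : Tendsto (fun N => ∏ k ∈ Finset.range N, if k = n then 1 else rfac x k t)
      atTop (𝓝 L)) :
    Φ (t : ℂ) = ((rfac x n t * L : ℝ) : ℂ) := by
  refine tendsto_nhds_unique (hΦ t) ?_
  have h2 : Tendsto (fun N => ((rfac x n t *
    ∏ k ∈ Finset.range N, (if k = n then 1 else rfac x k t) : ℝ) : ℂ)) atTop
    (𝓝 ((rfac x n t * L : ℝ) : ℂ)) :=
    (Complex.continuous_ofReal.tendsto _).comp (hL.const_mul _)
  refine h2.congr' ?_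
  filter_upwards [eventually_gt_atTop n] with N hN
  rw [← prod_split (fun k => rfac x k t) n N hN]
  push_cast
  exact Finset.prod_congr rfl fun k _ => (fac_ofReal x k t).symm

lemma l2_bound (f : ℕ → ℝ) (hf : Summable (fun n => f n ^ 2)) : ∃ M, 0 < M ∧ ∀ n, |f n| ≤ M := by
  have h0 : 0 ≤ ∑' n, f n ^ 2 := tsum_nonneg fun n => sq_nonneg _
  refine ⟨1 + ∑' n, f n ^ 2, by linarith, fun n => ?_⟩
  have := hf.le_tsum n (fun m _ => sq_nonneg (f m))
  rw [← sq_abs] at this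
  nlinarith [sq_nonneg (|f n| - 1), abs_nonneg (f n)]

lemma l2_tendsto (f : ℕ → ℝ) (hf : Summable (fun n => f n ^ 2)) : Tendsto f atTop (𝓝 0) := by
  have h1 := (Real.continuous_sqrt.tendsto 0).comp hf.tendsto_atTop_zero
  rw [tendsto_zero_iff_abs_tendsto_zero]
  simpa [Function.comp_def, Real.sqrt_sq_eq_abs] using h1

lemma l2_add (f g : ℕ → ℝ) (hf : Summable (fun n => f n ^ 2)) (hg : Summable (fun n => g n ^ 2)) :
    Summable (fun n => (f n + g n) ^ 2) := by
  refine Summable.of_nonneg_of_le (fun n => sq_nonneg _) (fun n => ?_)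
    ((hf.mul_left 2).add (hg.mul_left 2))
  nlinarith [sq_nonneg (f n - g n)]

lemma l2_of_le (f g : ℕ → ℝ) (C : ℝ) (hg : Summable (fun n => g n ^ 2))
    (h : ∀ᶠ n in atTop, |f n| ≤ C * |g n|) : Summable (fun n => f n ^ 2) := by
  refine Summable.of_norm_bounded_eventually_nat (hg.mul_left (C ^ 2)) ?_
  filter_upwards [h] with n hn
  rw [Real.norm_eq_abs, abs_of_nonneg (sq_nonneg _), ← sq_abs (f n), ← sq_abs (g n), ← mul_pow]
  exact pow_le_pow_left₀ (abs_nonneg _) hn 2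

lemma l2_inv : Summable (fun n : ℕ => (1 / ((n : ℝ) + 1)) ^ 2) := by
  have h1 : Summable (fun k : ℕ => 1 / |(k : ℝ) + 1| ^ (2 : ℝ)) :=
    (Real.summable_one_div_nat_add_rpow 1 2).2 (by norm_num)
  refine h1.congr fun k => ?_
  have hk : (0 : ℝ) ≤ k := Nat.cast_nonneg k
  rw [abs_of_pos (by positivity), Real.rpow_two, one_div_pow]

lemma l2_rpow : Summable (fun n : ℕ => (((n : ℝ) + 1) ^ (-(3 / 4) : ℝ)) ^ 2) := by
  have h1 : Summable (fun k : ℕ => 1 / |(k : ℝ) + 1| ^ (3 / 2 : ℝ)) :=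
    (Real.summable_one_div_nat_add_rpow 1 (3 / 2)).2 (by norm_num)
  refine h1.congr fun k => ?_
  have hk : (0 : ℝ) < (k : ℝ) + 1 := by positivity
  rw [abs_of_pos hk, ← Real.rpow_natCast, ← Real.rpow_mul hk.le, one_div, ← Real.rpow_neg hk.le]
  norm_num

lemma d_l2 (lam mu : ℕ → ℝ)
    (hlam : Summable (fun n : ℕ => (lam n - π * ((n : ℝ) + 1 / 2)) ^ 2))
    (hmu : Summable (fun n : ℕ => (mu n - π * ((n : ℝ) + 1 / 2)) ^ 2))
    (h : ℝ) (ν : ℕ → ℝ) (hν : Summable (fun n : ℕ => (ν n) ^ 2))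
    (hdiff : ∀ n : ℕ, lam n - mu n = h / (π * ((n : ℝ) + 1)) + ν n / ((n : ℝ) + 1)) :
    Summable (fun n => (lam n ^ 2 - mu n ^ 2 - 2 * h) ^ 2) := by
  obtain ⟨A, hA, hA'⟩ := l2_bound _ hlam
  obtain ⟨B, hB, hB'⟩ := l2_bound _ hmu
  obtain ⟨E, hE, hE'⟩ := l2_bound _ hν
  have hpi := Real.pi_pos
  have e : ∀ n : ℕ, lam n ^ 2 - mu n ^ 2 - 2 * h = 2 * π * ν n +
      (h / π + ν n) * (-π + (lam n - π * ((n : ℝ) + 1 / 2)) + (mu n - π * ((n : ℝ) + 1 / 2)))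
        * (1 / ((n : ℝ) + 1)) := by
    intro n
    have hn : (0 : ℝ) < (n : ℝ) + 1 := by positivity
    have e1 : lam n ^ 2 - mu n ^ 2 = (lam n - mu n) * (lam n + mu n) := by ring
    rw [e1, hdiff n]
    field_simp
    ring
  simp_rw [e]
  refine l2_add _ _ ?_ ?_
  · simp_rw [mul_pow]; exact hν.mul_left _
  · refine l2_of_le _ _ ((|h / π| + E) * (π + A + B)) l2_inv (Eventually.of_forall fun n => ?_)
    rw [abs_mul, abs_mul]
    have i1 : |h / π + ν n| ≤ |h / π| + E := (abs_add_le _ _).trans (by linarith [hE' n])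
    have i2 : |-π + (lam n - π * ((n : ℝ) + 1 / 2)) + (mu n - π * ((n : ℝ) + 1 / 2))|
        ≤ π + A + B := by
      have a1 := abs_le.1 (hA' n)
      have a2 := abs_le.1 (hB' n)
      rw [abs_le]; constructor <;> linarith
    gcongr

lemma gap (lam mu : ℕ → ℝ)
    (hlam : Summable (fun n : ℕ => (lam n - π * ((n : ℝ) + 1 / 2)) ^ 2))
    (hmu : Summable (fun n : ℕ => (mu n - π * ((n : ℝ) + 1 / 2)) ^ 2)) :
    ∃ N0 : ℕ, ∀ n ≥ N0, (n : ℝ) + 1 ≤ lam n ∧ ∀ k : ℕ, |(k : ℝ) - n| ≤ |mu k - lam n| := by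
  obtain ⟨M, hM, hM'⟩ := l2_bound _ hmu
  have e1 : ∀ᶠ n : ℕ in atTop, |lam n - π * ((n : ℝ) + 1 / 2)| ≤ 1 := by
    have := (l2_tendsto _ hlam).abs
    rw [abs_zero] at this
    exact this.eventually_le_const one_pos
  have e2 : ∀ᶠ n : ℕ in atTop, |mu n - π * ((n : ℝ) + 1 / 2)| ≤ 1 := by
    have := (l2_tendsto _ hmu).abs
    rw [abs_zero] at this
    exact this.eventually_le_const one_pos
  obtain ⟨K1, hK1⟩ := eventually_atTop.1 e1
  obtain ⟨K2, hK2⟩ := eventually_atTop.1 e2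
  obtain ⟨K3, hK3⟩ := exists_nat_ge (M + 1)
  have hpi := Real.pi_gt_three
  refine ⟨1 + K1 + K2 + K3, fun n hn => ⟨?_, fun k => ?_⟩⟩
  · have a1 := abs_le.1 (hK1 n (by omega))
    have : (1 : ℝ) ≤ n := by exact_mod_cast (by omega : 1 ≤ n)
    nlinarith
  · rcases eq_or_ne k n with rfl | hkn
    · simp
    have a1 := hK1 n (by omega)
    have key : π * |(k : ℝ) - n| ≤ |mu k - lam n| + |mu k - π * ((k : ℝ) + 1 / 2)|
        + |lam n - π * ((n : ℝ) + 1 / 2)| := by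
      rw [← abs_of_pos Real.pi_pos, ← abs_mul, abs_of_pos Real.pi_pos]
      have : π * ((k : ℝ) - n) = (mu k - lam n) - (mu k - π * ((k : ℝ) + 1 / 2))
        + (lam n - π * ((n : ℝ) + 1 / 2)) := by ring
      rw [this]
      refine (abs_add_le _ _).trans ?_
      gcongr
      exact abs_sub _ _
    by_cases hk : K2 ≤ k
    · have a2 := hK2 k hk
      have a3 : (1 : ℝ) ≤ |(k : ℝ) - n| := by
        have : (1 : ℤ) ≤ |(k : ℤ) - n| := Int.one_le_abs (by omega)
        exact_mod_cast this
      nlinarith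
    · have a2 := hM' k
      have a3 : M + 1 ≤ |(k : ℝ) - n| := by
        rw [abs_sub_comm]
        refine le_trans ?_ (le_abs_self _)
        have : (k : ℝ) + K3 ≤ n := by exact_mod_cast (by omega : k + K3 ≤ n)
        linarith
      nlinarith

lemma rpow_interp (m j w : ℝ) (hj : 0 < j) (hw : 0 < w) (h1 : j ≤ m) (h2 : w ≤ m) :
    j ^ (1 / 4 : ℝ) * w ^ (3 / 4 : ℝ) ≤ m := by
  have hm : 0 < m := hj.trans_le h1
  calc j ^ (1 / 4 : ℝ) * w ^ (3 / 4 : ℝ) ≤ m ^ (1 / 4 : ℝ) * m ^ (3 / 4 : ℝ) := by gcongr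
    _ = m := by rw [← Real.rpow_add hm]; norm_num

lemma sum_bound (lam mu : ℕ → ℝ) (hlampos : ∀ n, 0 < lam n) (hmupos : ∀ n, 0 < mu n)
    (hlam : Summable (fun n : ℕ => (lam n - π * ((n : ℝ) + 1 / 2)) ^ 2))
    (hmu : Summable (fun n : ℕ => (mu n - π * ((n : ℝ) + 1 / 2)) ^ 2))
    (D : ℝ) (hD : ∀ k, |lam k ^ 2 - mu k ^ 2| ≤ D) :
    ∃ C : ℝ, 0 ≤ C ∧ ∃ N0 : ℕ, ∀ n ≥ N0, ∀ T : Finset ℕ,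
      ∑ k ∈ T, ‖if k = n then 0 else (lam k ^ 2 - mu k ^ 2) / (mu k ^ 2 - lam n ^ 2)‖
        ≤ C * ((n : ℝ) + 1) ^ (-(3 / 4) : ℝ) := by
  obtain ⟨N0, hN0⟩ := gap lam mu hlam hmu
  have hD0 : 0 ≤ D := (abs_nonneg _).trans (hD 0)
  have hZ : Summable (fun m : ℤ => |(m : ℝ)| ^ (-(5 / 4) : ℝ)) :=
    Real.summable_abs_int_rpow (by norm_num)
  have hZ0 : ∀ m : ℤ, 0 ≤ |(m : ℝ)| ^ (-(5 / 4) : ℝ) := fun m => by positivity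
  refine ⟨D * ∑' m : ℤ, |(m : ℝ)| ^ (-(5 / 4) : ℝ), mul_nonneg hD0 (tsum_nonneg hZ0),
    N0, fun n hn T => ?_⟩
  obtain ⟨g1, g2⟩ := hN0 n hn
  have hw : (0 : ℝ) < (n : ℝ) + 1 := by positivity
  have term : ∀ k ∈ T, ‖if k = n then 0 else (lam k ^ 2 - mu k ^ 2) / (mu k ^ 2 - lam n ^ 2)‖
      ≤ D * ((n : ℝ) + 1) ^ (-(3 / 4) : ℝ) * |(((k : ℤ) - n : ℤ) : ℝ)| ^ (-(5 / 4) : ℝ) := by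
    intro k _
    split_ifs with hk
    · rw [norm_zero]; positivity
    · push_cast
      set j := |(k : ℝ) - n| with hj
      have hj0 : 0 < j := by
        rw [hj, abs_pos, sub_ne_zero]; exact_mod_cast hk
      have m1 : j ≤ mu k + lam n := (g2 k).trans (by
        have := hlampos n
        have := hmupos k
        rw [abs_le]; constructor <;> linarith)
      have m2 : (n : ℝ) + 1 ≤ mu k + lam n := by linarith [hmupos k]
      have m3 := rpow_interp _ j _ hj0 hw m1 m2
      have m4 : j * (j ^ (1 / 4 : ℝ) * ((n : ℝ) + 1) ^ (3 / 4 : ℝ)) ≤ |mu k ^ 2 - lam n ^ 2| := by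
        have : mu k ^ 2 - lam n ^ 2 = (mu k - lam n) * (mu k + lam n) := by ring
        rw [this, abs_mul, abs_of_pos (add_pos (hmupos k) (hlampos n))]
        exact mul_le_mul (g2 k) m3 (by positivity) (abs_nonneg _)
      rw [norm_div, Real.norm_eq_abs, Real.norm_eq_abs]
      have m5 : j * (j ^ (1 / 4 : ℝ) * ((n : ℝ) + 1) ^ (3 / 4 : ℝ)) =
          j ^ (5 / 4 : ℝ) * ((n : ℝ) + 1) ^ (3 / 4 : ℝ) := by
        rw [← mul_assoc]
        congr 1
        rw [show (5 / 4 : ℝ) = 1 + 1 / 4 by norm_num, Real.rpow_add hj0, Real.rpow_one]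
      rw [m5] at m4
      have m6 : |lam k ^ 2 - mu k ^ 2| / |mu k ^ 2 - lam n ^ 2| ≤
          D / (j ^ (5 / 4 : ℝ) * ((n : ℝ) + 1) ^ (3 / 4 : ℝ)) :=
        div_le_div₀ hD0 (hD k) (by positivity) m4
      refine m6.trans (le_of_eq ?_)
      rw [Real.rpow_neg hw.le, Real.rpow_neg hj0.le]
      field_simp
  refine (Finset.sum_le_sum term).trans ?_
  rw [← Finset.mul_sum]
  have hinj : Function.Injective (fun k : ℕ => (k : ℤ) - n) := fun a b hab => by
    simpa using hab
  have s1 : ∑ k ∈ T, |(((k : ℤ) - n : ℤ) : ℝ)| ^ (-(5 / 4) : ℝ)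
      ≤ ∑' m : ℤ, |(m : ℝ)| ^ (-(5 / 4) : ℝ) := by
    have := hZ.sum_le_tsum (T.map ⟨_, hinj⟩) (fun m _ => hZ0 m)
    rwa [Finset.sum_map] at this
  calc _ ≤ D * ((n : ℝ) + 1) ^ (-(3 / 4) : ℝ) * ∑' m : ℤ, |(m : ℝ)| ^ (-(5 / 4) : ℝ) := by gcongr
    _ = _ := by ring

lemma interlace (L U : ℕ → ℝ)
    (hinter : (∀ n : ℕ, L n < U n ∧ U n < L (n + 1)) ∨ (∀ n : ℕ, U n < L n ∧ L n < U (n + 1)))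
    (n k : ℕ) :
    (k < n → L k < L n ∧ U k < L n) ∧ (n < k → L n < L k ∧ L n < U k) := by
  rcases hinter with hi | hi
  · have hL : StrictMono L := strictMono_nat_of_lt_succ fun m => (hi m).1.trans (hi m).2
    refine ⟨fun hk => ⟨hL hk, (hi k).2.trans_le (hL.monotone hk)⟩, fun hk => ⟨hL hk, ?_⟩⟩
    exact (hL hk).trans (hi k).1
  · have hU : StrictMono U := strictMono_nat_of_lt_succ fun m => (hi m).1.trans (hi m).2
    have hL : StrictMono L := strictMono_nat_of_lt_succ fun m => (hi m).2.trans (hi (m + 1)).1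
    exact ⟨fun hk => ⟨hL hk, (hi k).1.trans (hL hk)⟩,
      fun hk => ⟨hL hk, (hi n).2.trans_le (hU.monotone hk)⟩⟩

end NC

open NC in
/-- Lemma 3.6. Sequences are indexed by `ℕ`, with index `n : ℕ`
standing for the subscript `n + 1`; thus `π (n - 1/2)` becomes `π (n + 1/2)`,
`h/(π n)` becomes `h/(π (n+1))`, and `ν_n / n` becomes `ν n / (n+1)`. -/
theorem norming_constants_positive_and_asymptotics
    (lam mu : ℕ → ℝ) (hlampos : ∀ n, 0 < lam n) (hmupos : ∀ n, 0 < mu n)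
    (hinter :
      (∀ n : ℕ, lam n ^ 2 < mu n ^ 2 ∧ mu n ^ 2 < lam (n + 1) ^ 2) ∨
      (∀ n : ℕ, mu n ^ 2 < lam n ^ 2 ∧ lam n ^ 2 < mu (n + 1) ^ 2))
    (hlam : Summable (fun n : ℕ => (lam n - π * ((n : ℝ) + 1 / 2)) ^ 2))
    (hmu : Summable (fun n : ℕ => (mu n - π * ((n : ℝ) + 1 / 2)) ^ 2))
    (h : ℝ) (hh : h ≠ 0)
    (ν : ℕ → ℝ) (hν : Summable (fun n : ℕ => (ν n) ^ 2))
    (hdiff : ∀ n : ℕ, lam n - mu n = h / (π * ((n : ℝ) + 1)) + ν n / ((n : ℝ) + 1))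
    (Φ₁ Φ₂ : ℂ → ℂ)
    (hΦ₁ : ∀ z : ℂ, Tendsto
      (fun N : ℕ => ∏ k ∈ Finset.range N,
        (((lam k : ℝ) : ℂ) ^ 2 - z ^ 2) / ((π : ℂ) ^ 2 * ((k : ℂ) + 1 / 2) ^ 2))
      atTop (𝓝 (Φ₁ z)))
    (hΦ₂ : ∀ z : ℂ, Tendsto
      (fun N : ℕ => ∏ k ∈ Finset.range N,
        (((mu k : ℝ) : ℂ) ^ 2 - z ^ 2) / ((π : ℂ) ^ 2 * ((k : ℂ) + 1 / 2) ^ 2))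
      atTop (𝓝 (Φ₂ z))) :
    Differentiable ℂ Φ₁ ∧
    (∀ n : ℕ, Φ₂ ((lam n : ℝ) : ℂ) ≠ 0) ∧
    ∃ α : ℕ → ℝ,
      (∀ n : ℕ, ((α n : ℝ) : ℂ) =
        ((h : ℝ) : ℂ) / ((lam n : ℝ) : ℂ) * deriv Φ₁ ((lam n : ℝ) : ℂ) / Φ₂ ((lam n : ℝ) : ℂ)) ∧
      (∀ n : ℕ, 0 < α n) ∧
      Summable (fun n : ℕ => (α n - 1) ^ 2) := by
  have hΦ₁' : ∀ z : ℂ, Tendsto (fun N : ℕ => ∏ k ∈ Finset.range N, fac lam k z) atTop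
    (𝓝 (Φ₁ z)) := hΦ₁
  have hΦ₂' : ∀ z : ℂ, Tendsto (fun N : ℕ => ∏ k ∈ Finset.range N, fac mu k z) atTop
    (𝓝 (Φ₂ z)) := hΦ₂
  have hpi := Real.pi_pos
  have hsep := interlace (fun n => lam n ^ 2) (fun n => mu n ^ 2) hinter
  have hneL : ∀ n k, k ≠ n → lam k ^ 2 ≠ lam n ^ 2 := by
    intro n k hk
    rcases lt_or_gt_of_ne hk with h1 | h1
    · exact ((hsep n k).1 h1).1.ne
    · exact ((hsep n k).2 h1).1.ne'
  have hneM : ∀ n k, k ≠ n → mu k ^ 2 ≠ lam n ^ 2 := by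
    intro n k hk
    rcases lt_or_gt_of_ne hk with h1 | h1
    · exact ((hsep n k).1 h1).2.ne
    · exact ((hsep n k).2 h1).2.ne'
  have hdne : ∀ n, mu n ^ 2 ≠ lam n ^ 2 := by
    intro n
    rcases hinter with hi | hi
    · exact (hi n).1.ne'
    · exact (hi n).1.ne
  have hd2 := d_l2 lam mu hlam hmu h ν hν hdiff
  have hdt : Tendsto (fun n => lam n ^ 2 - mu n ^ 2) atTop (𝓝 (2 * h)) := by
    have := (l2_tendsto _ hd2).add_const (2 * h)
    simpa using this
  have hq : ∀ n, 0 < 2 * h / (lam n ^ 2 - mu n ^ 2) := by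
    intro n
    rcases hinter with hi | hi
    · have h1 : 2 * h ≤ 0 := le_of_tendsto' hdt fun n => by linarith [(hi n).1]
      have h2 : 2 * h < 0 := lt_of_le_of_ne h1 (by simpa using hh)
      exact div_pos_of_neg_of_neg h2 (by linarith [(hi n).1])
    · have h1 : 0 ≤ 2 * h := ge_of_tendsto' hdt fun n => by linarith [(hi n).1]
      have h2 : 0 < 2 * h := lt_of_le_of_ne h1 (by simpa using hh)
      exact div_pos h2 (by linarith [(hi n).1])
  choose A hA0 hA using fun n => exists_limit lam hlam (lam n) n (hneL n)
  choose B hB0 hB using fun n => exists_limit mu hmu (lam n) n (hneM n)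
  have hder := fun n => phi_deriv lam hlam Φ₁ hΦ₁' n (A n) (hA n)
  have hval := fun n => phi_val mu Φ₂ hΦ₂' (lam n) n (B n) (hB n)
  have hr0 : ∀ n, rfac mu n (lam n) ≠ 0 := by
    intro n
    rw [rfac]
    have : mu n ^ 2 - lam n ^ 2 ≠ 0 := sub_ne_zero.2 (hdne n)
    positivity
  -- the partial ratios
  set b : ℕ → ℕ → ℝ := fun n k =>
    if k = n then 0 else (lam k ^ 2 - mu k ^ 2) / (mu k ^ 2 - lam n ^ 2) with hb
  have hratio : ∀ n, Tendsto (fun N => ∏ k ∈ Finset.range N, (1 + b n k)) atTop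
      (𝓝 (A n / B n)) := by
    intro n
    refine ((hA n).div (hB n) (hB0 n)).congr fun N => ?_
    rw [Pi.div_apply, ← Finset.prod_div_distrib]
    refine Finset.prod_congr rfl fun k _ => ?_
    by_cases hk : k = n
    · simp [hb, hk]
    · simp only [hb, if_neg hk, rfac]
      have : mu k ^ 2 - lam n ^ 2 ≠ 0 := sub_ne_zero.2 (hneM n k hk)
      field_simp
      ring
  have hbpos : ∀ n k, 0 < 1 + b n k := by
    intro n k
    by_cases hk : k = n
    · simp [hb, hk]
    · simp only [hb, if_neg hk]
      have h0 : mu k ^ 2 - lam n ^ 2 ≠ 0 := sub_ne_zero.2 (hneM n k hk)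
      have e : 1 + (lam k ^ 2 - mu k ^ 2) / (mu k ^ 2 - lam n ^ 2)
          = (lam k ^ 2 - lam n ^ 2) / (mu k ^ 2 - lam n ^ 2) := by
        field_simp
        ring
      rw [e]
      rcases lt_or_gt_of_ne hk with h1 | h1
      · have := (hsep n k).1 h1
        exact div_pos_of_neg_of_neg (by linarith) (by linarith)
      · have := (hsep n k).2 h1
        exact div_pos (by linarith) (by linarith)
  have hPpos : ∀ n, 0 < A n / B n := by
    intro n
    refine lt_of_le_of_ne ?_ (div_ne_zero (hA0 n) (hB0 n)).symm
    exact ge_of_tendsto' (hratio n) fun N => Finset.prod_nonneg fun k _ => (hbpos n k).le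
  refine ⟨phi_diff lam hlam Φ₁ hΦ₁', fun n => ?_,
    fun n => 2 * h / (lam n ^ 2 - mu n ^ 2) * (A n / B n), fun n => ?_,
    fun n => mul_pos (hq n) (hPpos n), ?_⟩
  · rw [hval n]
    exact_mod_cast mul_ne_zero (hr0 n) (hB0 n)
  · rw [hval n, hder n]
    rw [← Complex.ofReal_div, ← Complex.ofReal_mul, ← Complex.ofReal_div, Complex.ofReal_inj]
    have h0 : mu n ^ 2 - lam n ^ 2 ≠ 0 := sub_ne_zero.2 (hdne n)
    have h1 : lam n ^ 2 - mu n ^ 2 ≠ 0 := sub_ne_zero.2 (hdne n).symm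
    have h2 := (hlampos n).ne'
    have h3 := hB0 n
    have e : lam n ^ 2 - mu n ^ 2 = -(mu n ^ 2 - lam n ^ 2) := by ring
    simp only
    rw [e, rfac]
    field_simp
    try ring
  -- asymptotics
  obtain ⟨D0, hD0, hD0'⟩ := l2_bound _ hd2
  have hD : ∀ k, |lam k ^ 2 - mu k ^ 2| ≤ D0 + |2 * h| := fun k => by
    have : lam k ^ 2 - mu k ^ 2 = (lam k ^ 2 - mu k ^ 2 - 2 * h) + 2 * h := by ring
    rw [this]
    exact (abs_add_le _ _).trans (by linarith [hD0' k])
  obtain ⟨C, hC, N0, hN0⟩ := sum_bound lam mu hlampos hmupos hlam hmu _ hD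
  have hsmall : ∀ᶠ n : ℕ in atTop, C * ((n : ℝ) + 1) ^ (-(3 / 4) : ℝ) ≤ 1 := by
    have := (l2_tendsto _ l2_rpow).const_mul C
    rw [mul_zero] at this
    exact this.eventually_le_const one_pos
  have hP : ∀ᶠ n : ℕ in atTop,
      |A n / B n - 1| ≤ 2 * C * |((n : ℝ) + 1) ^ (-(3 / 4) : ℝ)| := by
    filter_upwards [hsmall, eventually_ge_atTop N0] with n hs hn
    have hw : 0 ≤ ((n : ℝ) + 1) ^ (-(3 / 4) : ℝ) := by positivity
    set S := C * ((n : ℝ) + 1) ^ (-(3 / 4) : ℝ) with hS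
    have hS0 : 0 ≤ S := mul_nonneg hC hw
    have t1 : Tendsto (fun N => |∏ k ∈ Finset.range N, (1 + b n k) - 1|) atTop
        (𝓝 |A n / B n - 1|) := ((hratio n).sub_const 1).abs
    refine le_of_tendsto' t1 fun N => ?_
    have u1 := Finset.norm_prod_one_add_sub_one_le (Finset.range N) (b n)
    have u2 := hN0 n hn (Finset.range N)
    have u3 := Real.exp_le_exp.2 u2
    have u4 := Real.abs_exp_sub_one_le (x := S) (by rwa [abs_of_nonneg hS0])
    rw [abs_of_nonneg hS0] at u4
    have u5 := (le_abs_self _).trans u4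
    rw [Real.norm_eq_abs] at u1
    rw [abs_of_nonneg hw]
    calc _ ≤ _ := u1
      _ ≤ Real.exp S - 1 := by linarith
      _ ≤ 2 * S := u5
      _ = _ := by rw [hS]; ring
  have habs : ∀ᶠ n : ℕ in atTop, |h| ≤ |lam n ^ 2 - mu n ^ 2| := by
    refine hdt.abs.eventually_const_le ?_
    rw [abs_mul, abs_two]
    linarith [abs_pos.2 hh]
  have hh0 := abs_pos.2 hh
  have hP2 : Summable (fun n => (2 * h / (lam n ^ 2 - mu n ^ 2) * (A n / B n - 1)) ^ 2) := by
    refine l2_of_le _ _ (2 * (2 * C)) l2_rpow ?_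
    filter_upwards [hP, habs] with n h1 h2
    have h3 : |2 * h / (lam n ^ 2 - mu n ^ 2)| ≤ 2 := by
      rw [abs_div, abs_mul, abs_two, div_le_iff₀ (by linarith)]
      linarith
    rw [abs_mul, mul_assoc]
    exact mul_le_mul h3 h1 (abs_nonneg _) (by norm_num)
  have hQ2 : Summable (fun n => (2 * h / (lam n ^ 2 - mu n ^ 2) - 1) ^ 2) := by
    refine l2_of_le _ _ (1 / |h|) hd2 ?_
    filter_upwards [habs] with n h2
    have h1 : lam n ^ 2 - mu n ^ 2 ≠ 0 := sub_ne_zero.2 (hdne n).symm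
    rw [div_sub_one h1, abs_div, abs_sub_comm, div_mul_eq_mul_div, one_mul]
    gcongr
  refine (l2_add _ _ hP2 hQ2).congr fun n => ?_
  ring
end

section
/- Let (λ_n)_{n≥1} be a sequence of positive real numbers with pairwise distinct squares such that λ_n = π(n−1/2) + λ̃_n with an ℓ²-sequence (λ̃_n), and define Φ₁(λ) := ∏_{k=1}^∞ (λ_k² − λ²)/(π²(k−1/2)²) for λ ∈ ℂ. Then Φ₁ is an entire function and the sequence (Φ₁′(λ_n) − (−1)ⁿ)_{n≥1} is an ℓ²-sequence, where Φ₁′ denotes the complex derivative of Φ₁. -/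
open MeasureTheory Filter Real Set
open scoped Topology

noncomputable def muR (k : ℕ) : ℝ := π * ((k : ℝ) + 1 / 2)

noncomputable def partP (lam : ℕ → ℝ) (N : ℕ) (z : ℂ) : ℂ := ∏ k ∈ Finset.range N,
        (((lam k : ℝ) : ℂ) ^ 2 - z ^ 2) / ((π : ℂ) ^ 2 * ((k : ℂ) + 1 / 2) ^ 2)

lemma muR_pos (k : ℕ) : 0 < muR k := by unfold muR; positivity

lemma den_eq (k : ℕ) : ((π : ℂ) ^ 2 * ((k : ℂ) + 1 / 2) ^ 2) = (muR k : ℂ) ^ 2 := by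
  unfold muR; push_cast; ring

lemma summable_inv_muR_sq : Summable (fun k : ℕ => 1 / muR k ^ 2) := by
  have h : Summable (fun k : ℕ => 1 / ((k : ℝ) + 1) ^ 2) := by
    have := (summable_nat_add_iff 1).2 (Real.summable_one_div_nat_pow (p := 2) |>.2 (by norm_num))
    simpa using this
  refine Summable.of_nonneg_of_le (fun k => by positivity) (fun k => ?_) h
  have hk := muR_pos k
  apply one_div_le_one_div_of_le (by positivity)
  apply pow_le_pow_left₀ (by positivity)
  unfold muR
  nlinarith [Real.pi_gt_three, Nat.cast_nonneg (α := ℝ) k]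

lemma partP_diff (lam : ℕ → ℝ) (N : ℕ) : Differentiable ℂ (partP lam N) := by
  unfold partP; fun_prop

lemma prod_main (lam : ℕ → ℝ) (hlam : Summable (fun n : ℕ => (lam n - muR n) ^ 2)) (z : ℂ) :
    ∃ g : ℂ → ℂ, TendstoLocallyUniformlyOn (partP lam) g atTop (Metric.ball z 1) := by
  set R : ℝ := ‖z‖ + 1
  let u : ℕ → ℝ := fun k => 2 * (lam k - muR k) ^ 2 * (1/muR 0 ^ 2) + ((lam k - muR k)^2 + 1 / muR k ^ 2) + R ^ 2 * (1 / muR k ^ 2)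
  have hu : Summable u :=
    (((hlam.mul_left 2).mul_right _).add (hlam.add summable_inv_muR_sq)).add
      (summable_inv_muR_sq.mul_left _)
  let f : ℕ → ℂ → ℂ := fun k w => (((lam k : ℝ) : ℂ) ^ 2 - w ^ 2 - (muR k : ℂ) ^ 2) / (muR k : ℂ) ^ 2
  have hf : ∀ k, ∀ w ∈ Metric.ball z 1, ‖f k w‖ ≤ u k := by
    intro k w hw
    have hw' : ‖w‖ ≤ R := by
      have : ‖w - z‖ < 1 := by simpa [dist_eq_norm] using hw
      calc ‖w‖ = ‖z + (w - z)‖ := by ring_nf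
        _ ≤ _ := norm_add_le _ _
        _ ≤ _ := by simp only [R]; linarith
    have hk := muR_pos k
    have h0 := muR_pos 0
    have hle : muR 0 ≤ muR k := by unfold muR; gcongr; simp
    have e : f k w = (((lam k ^ 2 - muR k ^ 2) / muR k ^ 2 : ℝ) : ℂ) - w ^ 2 / ((muR k ^ 2 : ℝ) : ℂ) := by
      simp only [f]; push_cast; ring
    rw [e]
    refine (norm_sub_le _ _).trans ?_
    rw [norm_div, norm_pow, Complex.norm_real, Complex.norm_real, Real.norm_eq_abs, Real.norm_eq_abs,
      abs_of_pos (by positivity : 0 < muR k ^ 2)]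
    have h1 : ‖w‖ ^ 2 / muR k ^ 2 ≤ R ^ 2 * (1 / muR k ^ 2) := by
      rw [mul_one_div]; gcongr
    have h2 : |(lam k ^ 2 - muR k ^ 2) / muR k ^ 2| ≤ 
        2 * (lam k - muR k) ^ 2 * (1/muR 0 ^ 2) + ((lam k - muR k)^2 + 1 / muR k ^ 2) := by
      have e2 : (lam k ^ 2 - muR k ^ 2) / muR k ^ 2 = (lam k - muR k) ^ 2 * (1 / muR k ^ 2) + 2 * ((lam k - muR k) * (1 / muR k)) := by
        field_simp; ring
      have h3 : 1 / muR k ^ 2 ≤ 1 / muR 0 ^ 2 := by gcongr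
      have h4 : (1 / muR k)^2 = 1 / muR k ^ 2 := by simp
      have h5 := mul_le_mul_of_nonneg_left h3 (sq_nonneg (lam k - muR k))
      have h6 : 0 ≤ (lam k - muR k) ^ 2 * (1 / muR k ^ 2) := by positivity
      rw [e2, abs_le]
      constructor <;> nlinarith [sq_nonneg (lam k - muR k - 1 / muR k), sq_nonneg (lam k - muR k + 1 / muR k)]
    simp only [u]; linarith
  have := Summable.hasProdLocallyUniformlyOn_nat_one_add (f := f) Metric.isOpen_ball hu
    (Eventually.of_forall hf) (fun k => by
      have : (muR k : ℂ) ^ 2 ≠ 0 := by have := (muR_pos k).ne'; exact_mod_cast pow_ne_zero 2 this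
      simp only [f]; fun_prop (disch := assumption))
  refine ⟨_, (this.tendstoLocallyUniformlyOn_finsetRange).congr (fun N w hw => ?_)⟩
  simp only [partP, f, den_eq]
  refine Finset.prod_congr rfl fun k _ => ?_
  have : (muR k : ℂ) ^ 2 ≠ 0 := by have := (muR_pos k).ne'; exact_mod_cast pow_ne_zero 2 this
  rw [sub_div, div_self this]; ring

lemma prod_diff (lam : ℕ → ℝ) (hlam : Summable (fun n : ℕ => (lam n - muR n) ^ 2)) (Φ : ℂ → ℂ)
    (z : ℂ) (hΦ : ∀ᶠ w in 𝓝 z, Tendsto (fun N => partP lam N w) atTop (𝓝 (Φ w))) :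
    DifferentiableAt ℂ Φ z ∧ Tendsto (fun N => deriv (partP lam N) z) atTop (𝓝 (deriv Φ z)) := by
  obtain ⟨g, hg⟩ := prod_main lam hlam z
  have hb : Metric.ball z 1 ∈ 𝓝 z := Metric.ball_mem_nhds z one_pos
  have he : Φ =ᶠ[𝓝 z] g := by
    filter_upwards [hΦ, hb] with w h1 h2
    exact tendsto_nhds_unique h1 (hg.tendsto_at h2)
  have hd : ∀ᶠ N in atTop, DifferentiableOn ℂ (partP lam N) (Metric.ball z 1) :=
    Eventually.of_forall fun N => (partP_diff lam N).differentiableOn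
  have h1 := hg.differentiableOn hd Metric.isOpen_ball
  have h2 := (hg.deriv hd Metric.isOpen_ball).tendsto_at (Metric.mem_ball_self one_pos)
  rw [he.deriv_eq]
  exact ⟨(h1.differentiableAt hb).congr_of_eventuallyEq he, h2⟩

lemma sin_cos_part (z : ℂ) (M : ℕ) :
    (π * (2 * z) * ∏ j ∈ Finset.range (2 * M), (1 - (2 * z) ^ 2 / ((j : ℂ) + 1) ^ 2)) =
    2 * (π * z * ∏ j ∈ Finset.range M, (1 - z ^ 2 / ((j : ℂ) + 1) ^ 2)) *
      partP muR M (π * z) := by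
  induction M with
  | zero => simp [partP]; ring
  | succ M ih =>
    rw [show 2 * (M + 1) = 2 * M + 1 + 1 by ring, Finset.prod_range_succ, Finset.prod_range_succ,
      ← mul_assoc, ← mul_assoc, ih, Finset.prod_range_succ]
    have e : partP muR (M + 1) (π * z) = partP muR M (π * z) * (1 - (2 * z) ^ 2 / (((2 * M : ℕ) : ℂ) + 1) ^ 2) := by
      unfold partP
      rw [Finset.prod_range_succ]
      congr 1
      have hp : (π : ℂ) ≠ 0 := by exact_mod_cast Real.pi_ne_zero
      have h1 : (2 * (M : ℂ) + 1) ≠ 0 := by norm_cast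
      have h2 : ((M : ℂ) + 1 / 2) ≠ 0 := by
        intro h; apply h1; linear_combination 2 * h
      unfold muR; push_cast
      have e3 : ((M : ℂ) + 1 / 2) = (2 * (M : ℂ) + 1) / 2 := by ring
      rw [e3]
      field_simp
      
    rw [e]
    have h1 : ((M : ℂ) + 1) ≠ 0 := by norm_cast
    have e4 : (2 * z) ^ 2 / (((2 * M + 1 : ℕ) : ℂ) + 1) ^ 2 = z ^ 2 / ((M : ℂ) + 1) ^ 2 := by
      push_cast
      rw [show (2 * (M : ℂ) + 1 + 1) = 2 * (M + 1) by ring]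
      field_simp
    rw [e4]; ring

lemma cos_prod (z : ℂ) (hz : Complex.sin z ≠ 0) :
    Tendsto (fun N => partP muR N z) atTop (𝓝 (Complex.cos z)) := by
  have hp : (π : ℂ) ≠ 0 := by exact_mod_cast Real.pi_ne_zero
  obtain ⟨w, rfl⟩ : ∃ w, z = π * w := ⟨z / π, by field_simp⟩
  have h1 := Complex.tendsto_euler_sin_prod w
  have h2 := (Complex.tendsto_euler_sin_prod (2 * w)).comp (tendsto_id.const_mul_atTop' (by norm_num : 0 < 2))
  have h3 := h2.div (h1.const_mul 2) (by simpa using hz)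
  have e : Complex.sin (π * (2 * w)) / (2 * Complex.sin (π * w)) = Complex.cos (π * w) := by
    rw [show (π : ℂ) * (2 * w) = 2 * (π * w) by ring, Complex.sin_two_mul]; field_simp
  rw [e] at h3
  refine h3.congr' ?_
  filter_upwards [h1.eventually_ne hz] with M hM
  simp only [Function.comp, id, Pi.div_apply]
  rw [sin_cos_part]
  exact mul_div_cancel_left₀ _ (mul_ne_zero two_ne_zero hM)

lemma cos_deriv (n : ℕ) :
    Tendsto (fun N => deriv (partP muR N) (muR n)) atTop (𝓝 ((-1) ^ (n + 1))) := by
  have hs : Complex.sin (muR n) = (-1) ^ n := by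
    have : (muR n : ℂ) = n * π + π / 2 := by unfold muR; push_cast; ring
    rw [this, Complex.sin_add_pi_div_two]
    exact_mod_cast congrArg ((↑) : ℝ → ℂ) (Real.cos_nat_mul_pi n)
  have hs0 : Complex.sin (muR n) ≠ 0 := by rw [hs]; exact pow_ne_zero _ (by norm_num)
  have h := (prod_diff muR (by simp) Complex.cos (muR n) (by
    filter_upwards [Complex.continuous_sin.continuousAt.eventually_ne hs0] with w hw using cos_prod w hw)).2
  rw [Complex.deriv_cos, hs] at h
  rw [pow_succ]; simpa using h

noncomputable def KK (m : ℤ) : ℝ := 1 / (m : ℝ)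

lemma KK_zero : KK 0 = 0 := by simp [KK]
lemma KK_neg (m : ℤ) : KK (-m) = - KK m := by simp [KK]

lemma KK_sq_summable : Summable (fun m : ℤ => KK m ^ 2) := by
  have := Real.summable_one_div_int_pow (p := 2) |>.2 (by norm_num)
  simpa [KK] using this

lemma KK_mul_summable (d : ℤ) : Summable (fun m : ℤ => KK m * KK (m + d)) := by
  have h1 := KK_sq_summable
  have h2 : Summable (fun m : ℤ => KK (m + d) ^ 2) :=
    (Equiv.addRight d).summable_iff.2 h1
  refine Summable.of_norm_bounded (h1.add h2) fun m => ?_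
  rw [Real.norm_eq_abs, abs_le]
  constructor <;> nlinarith [sq_nonneg (KK m - KK (m+d)), sq_nonneg (KK m + KK (m+d)), sq_nonneg (KK m), sq_nonneg (KK (m+d))]

lemma KK_decomp (d : ℤ) (hd : d ≠ 0) (m : ℤ) : KK m * KK (m + d) =
    KK d * (KK m - KK (m + d)) + KK d ^ 2 * ((if m = 0 then 1 else 0) + (if m = -d then 1 else 0)) := by
  have hd' : (d : ℝ) ≠ 0 := by exact_mod_cast hd
  by_cases h0 : m = 0
  · subst h0; simp [KK_zero, hd, eq_comm]; ring
  by_cases h1 : m = -d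
  · subst h1; simp [KK_zero, hd, KK_neg]; ring
  have h0' : (m : ℝ) ≠ 0 := by exact_mod_cast h0
  have h1' : (m : ℝ) + d ≠ 0 := by
    have : m + d ≠ 0 := by omega
    exact_mod_cast this
  simp [h0, h1, KK]; field_simp; ring

lemma ind_hasSum (c : ℤ) : HasSum (fun m : ℤ => if m = c then (1 : ℝ) else 0) 1 :=
  hasSum_ite_eq c 1

lemma KK_diff_summable (d : ℤ) : Summable (fun m : ℤ => KK m - KK (m + d)) := by
  by_cases hd : d = 0
  · subst hd; simp
  have hd' : (d : ℝ) ≠ 0 := by exact_mod_cast hd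
  have h := ((KK_mul_summable d).sub (((ind_hasSum 0).summable.add (ind_hasSum (-d)).summable).mul_left (KK d ^ 2))).mul_left (d : ℝ)
  refine h.congr fun m => ?_
  rw [KK_decomp d hd]
  have : (d : ℝ) * KK d = 1 := by simp [KK, hd']
  linear_combination (KK m - KK (m + d)) * this

lemma KK_diff_one : HasSum (fun m : ℤ => KK m - KK (m + 1)) 0 := by
  have hs := KK_diff_summable 1
  have hn : HasSum (fun k : ℕ => KK k - KK (k + 1)) 0 := by
    have hs' : Summable (fun k : ℕ => KK k - KK (k + 1)) := hs.comp_injective Nat.cast_injective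
    rw [hs'.hasSum_iff_tendsto_nat]
    have : ∀ N : ℕ, ∑ k ∈ Finset.range N, (KK k - KK (k + 1)) = - (1 / (N : ℝ)) := by
      intro N
      have := Finset.sum_range_sub' (fun k : ℕ => KK k) N
      push_cast at this
      rw [this, KK_zero]; simp [KK]
    simp_rw [this]
    simpa using (tendsto_one_div_atTop_nhds_zero_nat (𝕜 := ℝ)).neg
  have := HasSum.of_nat_of_neg_add_one (f := fun m : ℤ => KK m - KK (m + 1)) hn (m' := 0) (by
    convert hn using 2 with k
    rw [KK_neg, show -((k : ℤ) + 1) + 1 = -k by ring, KK_neg]; ring)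
  simpa using this

lemma KK_diff (d : ℤ) : HasSum (fun m : ℤ => KK m - KK (m + d)) 0 := by
  induction d using Int.induction_on with
  | zero => simp
  | succ i ih =>
    have := ih.add ((Equiv.addRight (i : ℤ)).hasSum_iff.2 KK_diff_one)
    rw [zero_add] at this
    refine this.congr_fun fun m => ?_
    simp [add_assoc]
  | pred i ih =>
    have := ih.sub ((Equiv.addRight (-(i : ℤ) - 1)).hasSum_iff.2 KK_diff_one)
    rw [sub_zero] at this
    refine this.congr_fun fun m => ?_
    simp only [Function.comp, Equiv.coe_addRight]
    rw [show m + (-(i : ℤ) - 1) + 1 = m + -i by ring]; ring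

noncomputable def HH (d : ℤ) : ℝ := 2 * KK d ^ 2 + (if d = 0 then ∑' m, KK m ^ 2 else 0)

lemma HH_nonneg (d : ℤ) : 0 ≤ HH d := by
  unfold HH
  have : 0 ≤ ∑' m, KK m ^ 2 := tsum_nonneg fun m => sq_nonneg _
  split_ifs <;> positivity

lemma HH_summable : Summable HH :=
  (KK_sq_summable.mul_left 2).add (hasSum_ite_eq (0 : ℤ) _).summable

lemma HH_hasSum (d : ℤ) : HasSum (fun m : ℤ => KK m * KK (m + d)) (HH d) := by
  by_cases hd : d = 0
  · subst hd
    simpa [HH, KK_zero, sq] using KK_sq_summable.hasSum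
  have h := ((KK_diff d).mul_left (KK d)).add (((ind_hasSum 0).add (ind_hasSum (-d))).mul_left (KK d ^ 2))
  have e : HH d = KK d * 0 + KK d ^ 2 * (1 + 1) := by simp [HH, hd]; ring
  rw [e]
  exact h.congr_fun fun m => KK_decomp d hd m

lemma HH_hasSum' (j k : ℤ) : HasSum (fun n : ℤ => KK (j - n) * KK (k - n)) (HH (k - j)) := by
  convert (Equiv.subLeft j).hasSum_iff.2 (HH_hasSum (k - j)) using 2 with n
  simp

lemma hilbert_fin (f : ℤ → ℝ) (F S : Finset ℤ) :
    ∑ n ∈ S, (∑ j ∈ F, f j * KK (j - n)) ^ 2 ≤ (∑' d, HH d) * ∑ j ∈ F, f j ^ 2 := by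
  have h1 : HasSum (fun n : ℤ => (∑ j ∈ F, f j * KK (j - n)) ^ 2)
      (∑ j ∈ F, ∑ k ∈ F, f j * f k * HH (k - j)) := by
    have : ∀ n, (∑ j ∈ F, f j * KK (j - n)) ^ 2 =
        ∑ j ∈ F, ∑ k ∈ F, f j * f k * (KK (j - n) * KK (k - n)) := by
      intro n
      rw [sq, Finset.sum_mul_sum]
      refine Finset.sum_congr rfl fun j _ => Finset.sum_congr rfl fun k _ => by ring
    simp_rw [this]
    exact hasSum_sum fun j _ => hasSum_sum fun k _ => (HH_hasSum' j k).mul_left _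
  refine (sum_le_hasSum S (fun _ _ => sq_nonneg _) h1).trans ?_
  have hA : ∀ j, ∑ k ∈ F, HH (k - j) ≤ ∑' d, HH d := by
    intro j
    rw [← (Equiv.subRight j).tsum_eq HH]
    exact ((Equiv.subRight j).summable_iff.2 HH_summable).sum_le_tsum F (fun k _ => HH_nonneg _)
  have hB : ∀ k, ∑ j ∈ F, HH (k - j) ≤ ∑' d, HH d := by
    intro j
    rw [← (Equiv.subLeft j).tsum_eq HH]
    exact ((Equiv.subLeft j).summable_iff.2 HH_summable).sum_le_tsum F (fun k _ => HH_nonneg _)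
  have h2 : ∑ j ∈ F, ∑ k ∈ F, f j * f k * HH (k - j) ≤
      ∑ j ∈ F, ∑ k ∈ F, (f j ^ 2 / 2 * HH (k - j) + f k ^ 2 / 2 * HH (k - j)) := by
    refine Finset.sum_le_sum fun j _ => Finset.sum_le_sum fun k _ => ?_
    rw [← add_mul]
    refine mul_le_mul_of_nonneg_right ?_ (HH_nonneg _)
    nlinarith [sq_nonneg (f j - f k)]
  refine h2.trans ?_
  simp_rw [Finset.sum_add_distrib]
  rw [Finset.sum_comm (f := fun j k => f k ^ 2 / 2 * HH (k - j))]
  simp_rw [← Finset.mul_sum]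
  rw [Finset.mul_sum, ← Finset.sum_add_distrib]
  refine Finset.sum_le_sum fun j _ => ?_
  have := hA j
  have := hB j
  have := sq_nonneg (f j)
  nlinarith

lemma hil_summable (f : ℤ → ℝ) (hf : Summable fun j => f j ^ 2) (n : ℤ) :
    Summable fun j => f j * KK (j - n) := by
  have h2 : Summable (fun m : ℤ => KK (m - n) ^ 2) :=
    (Equiv.subRight n).summable_iff.2 KK_sq_summable
  refine Summable.of_norm_bounded (hf.add h2) fun m => ?_
  rw [Real.norm_eq_abs, abs_le]
  constructor <;> nlinarith [sq_nonneg (f m - KK (m-n)), sq_nonneg (f m + KK (m-n)), sq_nonneg (f m), sq_nonneg (KK (m-n))]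

lemma hilbert_summable (f : ℤ → ℝ) (hf : Summable fun j => f j ^ 2) :
    Summable fun n => (∑' j, f j * KK (j - n)) ^ 2 := by
  refine summable_of_sum_le (c := (∑' d, HH d) * ∑' j, f j ^ 2) (fun _ => sq_nonneg _) fun S => ?_
  have : Tendsto (fun F : Finset ℤ => ∑ n ∈ S, (∑ j ∈ F, f j * KK (j - n)) ^ 2) atTop
      (𝓝 (∑ n ∈ S, (∑' j, f j * KK (j - n)) ^ 2)) :=
    tendsto_finsetSum S fun n _ => (hil_summable f hf n).hasSum.pow 2
  refine le_of_tendsto' this fun F => (hilbert_fin f F S).trans ?_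
  exact mul_le_mul_of_nonneg_left (hf.sum_le_tsum F fun _ _ => sq_nonneg _) (tsum_nonneg HH_nonneg)

/-- symmetric partial sums of the kernel -/
lemma KK_sym (n : ℕ) : HasSum (fun k : ℕ => KK (k - n) + KK (-((k : ℤ) + 1) - n)) 0 := by
  have h := ((Equiv.subRight (n : ℤ)).hasSum_iff.2 (KK_diff (2 * n + 1)))
  have h2 := h.nat_add_neg_add_one.mul_left (1 / 2 : ℝ)
  rw [mul_zero] at h2
  refine h2.congr_fun fun k => ?_
  simp only [Function.comp, Equiv.subRight_apply]
  rw [show -((k : ℤ) + 1) - n + (2 * n + 1) = -(k - n) by ring,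
    show (k : ℤ) - n + (2 * n + 1) = -(-((k : ℤ) + 1) - n) by ring, KK_neg, KK_neg]
  ring

def TT (t : ℕ → ℝ) : ℤ → ℝ
  | Int.ofNat k => t k
  | Int.negSucc k => - t k

lemma TT_nat (t : ℕ → ℝ) (k : ℕ) : TT t (k : ℤ) = t k := rfl
lemma TT_neg (t : ℕ → ℝ) (k : ℕ) : TT t (-((k : ℤ) + 1)) = - t k := by
  rw [← Int.negSucc_eq]; rfl

lemma TT_summable (t : ℕ → ℝ) (ht : Summable fun k => t k ^ 2) :
    Summable fun j : ℤ => TT t j ^ 2 := by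
  refine Summable.of_nat_of_neg_add_one ?_ ?_
  · simpa [TT_nat] using ht
  · simp only [TT_neg, neg_sq]; exact ht

noncomputable def xx (T : ℤ → ℝ) (n j : ℤ) : ℝ := (T j - T n) / π * KK (j - n)

lemma xx_sq_summable_prod (T : ℤ → ℝ) (hT : Summable fun j => T j ^ 2) :
    Summable fun p : ℤ × ℤ => xx T p.1 p.2 ^ 2 := by
  have h := hT.mul_of_nonneg KK_sq_summable (fun _ => sq_nonneg _) (fun _ => sq_nonneg _)
  have h1 : Summable fun p : ℤ × ℤ => T p.2 ^ 2 * KK (p.2 - p.1) ^ 2 :=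
    h.comp_injective (i := fun p : ℤ × ℤ => (p.2, p.2 - p.1)) (by
      rintro ⟨a, b⟩ ⟨c, d⟩ h; simp at h; ext <;> simp <;> omega)
  have h2 : Summable fun p : ℤ × ℤ => T p.1 ^ 2 * KK (p.2 - p.1) ^ 2 :=
    h.comp_injective (i := fun p : ℤ × ℤ => (p.1, p.2 - p.1)) (by
      rintro ⟨a, b⟩ ⟨c, d⟩ h; simp at h; ext <;> simp <;> omega)
  refine Summable.of_nonneg_of_le (fun _ => sq_nonneg _) (fun p => ?_) ((h1.add h2).mul_left 2)
  unfold xx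
  rw [mul_pow, ← add_mul, ← mul_assoc]
  refine mul_le_mul_of_nonneg_right ?_ (sq_nonneg _)
  rw [div_pow]
  refine (div_le_self (sq_nonneg _) ?_).trans ?_
  · nlinarith [Real.pi_gt_three]
  · nlinarith [sq_nonneg (T p.1 + T p.2)]

noncomputable def bb (T : ℤ → ℝ) (n : ℤ) : ℝ := ∑' j, xx T n j ^ 2
noncomputable def aa (T : ℤ → ℝ) (n : ℤ) : ℝ := (∑' j, T j * KK (j - n)) / π
noncomputable def aN (T : ℤ → ℝ) (n : ℤ) (N : ℕ) : ℝ :=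
  ∑ k ∈ Finset.range N, (xx T n k + xx T n (-((k : ℤ) + 1)))
noncomputable def RN (T : ℤ → ℝ) (n : ℤ) (N : ℕ) : ℝ :=
  ∏ k ∈ Finset.range N, ((1 + xx T n k) * (1 + xx T n (-((k : ℤ) + 1))))

lemma bb_summable (T : ℤ → ℝ) (hT : Summable fun j => T j ^ 2) : Summable (bb T) :=
  (xx_sq_summable_prod T hT).prod

lemma xx_sq_summable (T : ℤ → ℝ) (hT : Summable fun j => T j ^ 2) (n : ℤ) :
    Summable fun j => xx T n j ^ 2 := (xx_sq_summable_prod T hT).prod_factor n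

lemma aa_summable (T : ℤ → ℝ) (hT : Summable fun j => T j ^ 2) :
    Summable fun n => aa T n ^ 2 := by
  simp only [aa, div_pow]
  exact (hilbert_summable T hT).div_const _

lemma aN_tendsto (T : ℤ → ℝ) (hT : Summable fun j => T j ^ 2) (n : ℕ) :
    Tendsto (aN T n) atTop (𝓝 (aa T n)) := by
  have h1 := (hil_summable T hT n).hasSum.nat_add_neg_add_one
  have h2 := (h1.sub ((KK_sym n).mul_left (T n))).div_const π
  rw [mul_zero, sub_zero] at h2
  refine h2.tendsto_sum_nat.congr fun N => ?_
  unfold aN xx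
  refine Finset.sum_congr rfl fun k _ => ?_
  ring

lemma log_bound (x : ℝ) (hx : x ^ 2 ≤ 1 / 4) : 0 < 1 + x ∧ |Real.log (1 + x) - x| ≤ 2 * x ^ 2 := by
  have hx' : |x| ≤ 1 / 2 := by
    apply abs_le_of_sq_le_sq _ (by norm_num); norm_num; linarith
  rw [abs_le] at hx'
  have hp : 0 < 1 + x := by linarith
  refine ⟨hp, ?_⟩
  have h1 := Real.log_le_sub_one_of_pos hp
  have h2 := Real.one_sub_inv_le_log_of_pos hp
  have h3 : 1 - (1 + x)⁻¹ = x - x ^ 2 / (1 + x) := by field_simp; ring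
  have h4 : x ^ 2 / (1 + x) ≤ 2 * x ^ 2 := by
    rw [div_le_iff₀ hp]; nlinarith [sq_nonneg x]
  rw [abs_le]; constructor <;> nlinarith [sq_nonneg x]

lemma RN_bound (T : ℤ → ℝ) (hT : Summable fun j => T j ^ 2) (n : ℤ) (N : ℕ)
    (hb : bb T n ≤ 1 / 4) (ha : |aN T n N| + 2 * bb T n ≤ 1) :
    |RN T n N - 1| ≤ 2 * (|aN T n N| + 2 * bb T n) := by
  have hs := xx_sq_summable T hT n
  have hx : ∀ j, xx T n j ^ 2 ≤ 1 / 4 := fun j =>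
    (hs.le_tsum j (fun _ _ => sq_nonneg _)).trans hb
  set s := ∑ k ∈ Finset.range N, (Real.log (1 + xx T n k) + Real.log (1 + xx T n (-((k : ℤ) + 1)))) with hsdef
  have hR : RN T n N = Real.exp s := by
    rw [hsdef, Real.exp_sum]
    refine Finset.prod_congr rfl fun k _ => ?_
    rw [Real.exp_add, Real.exp_log (log_bound _ (hx _)).1, Real.exp_log (log_bound _ (hx _)).1]
  have h1 : |s - aN T n N| ≤ 2 * bb T n := by
    rw [hsdef, aN, ← Finset.sum_sub_distrib]
    refine (Finset.abs_sum_le_sum_abs _ _).trans ?_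
    have h2 := sum_le_hasSum (Finset.range N) (fun k _ => by positivity) hs.hasSum.nat_add_neg_add_one
    have h3 : ∑ k ∈ Finset.range N, 2 * (xx T n k ^ 2 + xx T n (-((k : ℤ) + 1)) ^ 2) ≤ 2 * bb T n := by
      rw [← Finset.mul_sum]; unfold bb; linarith
    refine le_trans (Finset.sum_le_sum fun k _ => ?_) h3
    have e1 := (log_bound _ (hx k)).2
    have e2 := (log_bound _ (hx (-((k : ℤ) + 1)))).2
    rw [abs_le] at *
    constructor <;> linarith
  have h4 : |s| ≤ |aN T n N| + 2 * bb T n := by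
    have := abs_sub_abs_le_abs_sub s (aN T n N)
    linarith
  rw [hR]
  exact (Real.abs_exp_sub_one_le (h4.trans ha)).trans (by linarith)

lemma partP_deriv (lam : ℕ → ℝ) (n N : ℕ) (hn : n < N) :
    deriv (partP lam N) (lam n) =
      ((∏ k ∈ (Finset.range N).erase n, (lam k ^ 2 - lam n ^ 2) / muR k ^ 2) *
        (-2 * lam n / muR n ^ 2) : ℝ) := by
  have e : partP lam N = fun z => (∏ k ∈ (Finset.range N).erase n,
      (((lam k : ℝ) : ℂ) ^ 2 - z ^ 2) / (muR k : ℂ) ^ 2) *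
        ((((lam n : ℝ) : ℂ) ^ 2 - z ^ 2) / (muR n : ℂ) ^ 2) := by
    ext z
    simp only [partP, den_eq]
    rw [Finset.prod_erase_mul _ _ (Finset.mem_range.2 hn)]
  have h1 : HasDerivAt (fun z : ℂ => (((lam n : ℝ) : ℂ) ^ 2 - z ^ 2) / (muR n : ℂ) ^ 2)
      (-2 * lam n / muR n ^ 2) (lam n : ℂ) := by
    have := (((hasDerivAt_pow 2 (lam n : ℂ)).const_sub (((lam n : ℝ) : ℂ) ^ 2)).div_const ((muR n : ℂ) ^ 2))
    refine this.congr_deriv ?_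
    simp
  have h2 : DifferentiableAt ℂ (fun z : ℂ => ∏ k ∈ (Finset.range N).erase n,
      (((lam k : ℝ) : ℂ) ^ 2 - z ^ 2) / (muR k : ℂ) ^ 2) (lam n : ℂ) := by fun_prop
  rw [e, HasDerivAt.deriv (h2.hasDerivAt.fun_mul h1)]
  push_cast
  simp

lemma ratio (lam : ℕ → ℝ) (n N : ℕ) (hn : n < N) :
    deriv (partP lam N) (lam n) = deriv (partP muR N) (muR n) *
      (RN (TT fun k => lam k - muR k) n N : ℝ) := by
  rw [partP_deriv lam n N hn, partP_deriv muR n N hn, RN,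
    ← Finset.prod_erase_mul _ _ (Finset.mem_range.2 hn)]
  rw [← Complex.ofReal_mul]
  congr 1
  have hpi := Real.pi_ne_zero
  have h1 : lam n = muR n * ((1 + xx (TT fun k => lam k - muR k) n n) *
      (1 + xx (TT fun k => lam k - muR k) n (-((n : ℤ) + 1)))) := by
    simp only [xx, TT_nat, TT_neg, KK]
    unfold muR
    push_cast
    have h : (-((n : ℝ) + 1) - n) ≠ 0 := by
      have := Nat.cast_nonneg (α := ℝ) n
      intro h; linarith
    field_simp
    ring
  have h2 : ∏ k ∈ (Finset.range N).erase n, (lam k ^ 2 - lam n ^ 2) / muR k ^ 2 =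
      (∏ k ∈ (Finset.range N).erase n, (muR k ^ 2 - muR n ^ 2) / muR k ^ 2) *
      ∏ k ∈ (Finset.range N).erase n, ((1 + xx (TT fun k => lam k - muR k) n k) *
        (1 + xx (TT fun k => lam k - muR k) n (-((k : ℤ) + 1)))) := by
    rw [← Finset.prod_mul_distrib]
    refine Finset.prod_congr rfl fun k hk => ?_
    have hkn : (k : ℝ) - n ≠ 0 := by
      have := (Finset.mem_erase.1 hk).1
      rw [sub_ne_zero]; exact_mod_cast this
    have hkn2 : (-((k : ℝ) + 1) - n) ≠ 0 := by
      have := Nat.cast_nonneg (α := ℝ) n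
      have := Nat.cast_nonneg (α := ℝ) k
      intro h; linarith
    have f1 : 1 + xx (TT fun k => lam k - muR k) n k = (lam k - lam n) / (muR k - muR n) := by
      have : muR k - muR n = π * ((k : ℝ) - n) := by unfold muR; ring
      simp only [xx, TT_nat, KK]
      rw [show lam k - muR k - (lam n - muR n) = lam k - lam n - (muR k - muR n) by ring, this]
      push_cast
      field_simp
      ring
    have f2 : 1 + xx (TT fun k => lam k - muR k) n (-((k : ℤ) + 1)) = (lam k + lam n) / (muR k + muR n) := by
      have : muR k + muR n = - π * (-((k : ℝ) + 1) - n) := by unfold muR; ring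
      simp only [xx, TT_nat, TT_neg, KK]
      rw [show -(lam k - muR k) - (lam n - muR n) = -(lam k + lam n) + (muR k + muR n) by ring, this]
      push_cast
      field_simp
      ring
    have g1 : muR k - muR n ≠ 0 := by
      have : muR k - muR n = π * ((k : ℝ) - n) := by unfold muR; ring
      rw [this]; exact mul_ne_zero hpi hkn
    have g2 : muR k + muR n ≠ 0 := (add_pos (muR_pos k) (muR_pos n)).ne'
    have g3 := (muR_pos k).ne'
    rw [f1, f2, show muR k ^ 2 - muR n ^ 2 = (muR k - muR n) * (muR k + muR n) by ring]
    field_simp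
    ring
  rw [h2]
  conv_lhs => rw [h1]
  ring

theorem derivative_of_Phi1_asymptotics
    (lam : ℕ → ℝ) (hlampos : ∀ n, 0 < lam n)
    (hdist : Function.Injective (fun n : ℕ => lam n ^ 2))
    (hlam : Summable (fun n : ℕ => (lam n - π * ((n : ℝ) + 1 / 2)) ^ 2))
    (Φ₁ : ℂ → ℂ)
    (hΦ₁ : ∀ z : ℂ, Tendsto
      (fun N : ℕ => ∏ k ∈ Finset.range N,
        (((lam k : ℝ) : ℂ) ^ 2 - z ^ 2) / ((π : ℂ) ^ 2 * ((k : ℂ) + 1 / 2) ^ 2))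
      atTop (𝓝 (Φ₁ z))) :
    Differentiable ℂ Φ₁ ∧
    Summable (fun n : ℕ => ‖deriv Φ₁ ((lam n : ℝ) : ℂ) - (-1 : ℂ) ^ (n + 1)‖ ^ 2) := by
  have hl : Summable (fun n : ℕ => (lam n - muR n) ^ 2) := hlam
  have hP : ∀ z, DifferentiableAt ℂ Φ₁ z ∧
      Tendsto (fun N => deriv (partP lam N) z) atTop (𝓝 (deriv Φ₁ z)) := fun z =>
    prod_diff lam hl Φ₁ z (Eventually.of_forall hΦ₁)
  refine ⟨fun z => (hP z).1, ?_⟩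
  set T := TT fun k => lam k - muR k with hTdef
  have hT : Summable fun j => T j ^ 2 := TT_summable _ hl
  have hbs : Summable fun n : ℕ => bb T n := (bb_summable T hT).comp_injective Nat.cast_injective
  have has : Summable fun n : ℕ => aa T n ^ 2 := (aa_summable T hT).comp_injective Nat.cast_injective
  refine Summable.of_norm_bounded_eventually_nat ((has.mul_left 8).add (hbs.mul_left 8)) ?_
  filter_upwards [hbs.tendsto_atTop_zero.eventually_lt_const (by norm_num : (0 : ℝ) < 1 / 8),
    has.tendsto_atTop_zero.eventually_lt_const (by norm_num : (0 : ℝ) < 1 / 16)] with n hb ha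
  have hb0 : 0 ≤ bb T n := tsum_nonneg fun _ => sq_nonneg _
  have ha' : |aa T n| ≤ 1 / 4 := by
    apply abs_le_of_sq_le_sq _ (by norm_num); norm_num; linarith
  have hD := cos_deriv n
  have haN := aN_tendsto T hT n
  have hlim : Tendsto (fun N => ‖deriv (partP lam N) (lam n) - deriv (partP muR N) (muR n)‖) atTop
      (𝓝 ‖deriv Φ₁ (lam n) - (-1) ^ (n + 1)‖) := ((hP (lam n)).2.sub hD).norm
  have hlim2 : Tendsto (fun N => ‖deriv (partP muR N) (muR n)‖ * (2 * (|aN T n N| + 2 * bb T n))) atTop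
      (𝓝 (‖((-1 : ℂ)) ^ (n + 1)‖ * (2 * (|aa T n| + 2 * bb T n)))) :=
    hD.norm.mul ((haN.abs.add_const _).const_mul 2)
  have hle : ‖deriv Φ₁ (lam n) - (-1) ^ (n + 1)‖ ≤ 2 * (|aa T n| + 2 * bb T n) := by
    have := le_of_tendsto_of_tendsto hlim hlim2 (by
      filter_upwards [eventually_gt_atTop n,
        haN.abs.eventually_lt_const (by linarith : |aa T n| < 1 / 2)] with N hN haN'
      rw [ratio lam n N hN, ← mul_sub_one, norm_mul]
      refine mul_le_mul_of_nonneg_left ?_ (norm_nonneg _)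
      have := RN_bound T hT n N (by linarith) (by linarith)
      rw [← Complex.ofReal_one, ← Complex.ofReal_sub, Complex.norm_real, Real.norm_eq_abs]
      exact this)
    simpa using this
  rw [Real.norm_eq_abs, abs_of_nonneg (sq_nonneg _)]
  have h0 := norm_nonneg (deriv Φ₁ (lam n) - (-1) ^ (n + 1))
  have h3 := pow_le_pow_left₀ h0 hle 2
  refine h3.trans ?_
  have := sq_abs (aa T n)
  nlinarith [sq_nonneg (|aa T n| - 2 * bb T n), mul_nonneg hb0 (by linarith : 0 ≤ 1 / 4 - bb T n)]
end

section
/- Let (λ_n)_{n≥1} and (μ_n)_{n≥1} be sequences of positive real numbers such that: λ_n = π(n−1/2) + λ̃_n and μ_n = π(n−1/2) + μ̃_n with ℓ²-sequences (λ̃_n) and (μ̃_n); the numbers μ_n² are pairwise distinct; and λ_n − μ_n = h/(πn) + ν_n/n for some real h and an ℓ²-sequence (ν_n). Define Φ₂(λ) := ∏_{k=1}^∞ (μ_k² − λ²)/(π²(k−1/2)²) for λ ∈ ℂ. Then there exists an ℓ²-sequence (μ̂_n)_{n≥1} such that Φ₂(λ_n) = (λ_n − μ_n)·((−1)ⁿ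 + μ̂_n) for all n. -/
open MeasureTheory Filter Real Set
open scoped Topology

/-- The kernel `1/j` on the integers (with value `0` at `0`). -/
noncomputable def uK (j : ℤ) : ℝ := (j : ℝ)⁻¹

lemma uK_zero : uK 0 = 0 := by simp [uK]

lemma uK_sq_summable : Summable (fun j : ℤ => uK j ^ 2) := by
  have := (Real.summable_one_div_int_pow (p := 2)).2 (by norm_num)
  refine this.congr fun j => ?_
  simp [uK]

lemma uK_sq_summable_sub (k : ℤ) : Summable (fun n : ℤ => uK (k - n) ^ 2) :=
  (Equiv.subLeft k).summable_iff.2 uK_sq_summable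

lemma uK_sq_summable_sub' (k : ℤ) : Summable (fun n : ℤ => uK (n - k) ^ 2) :=
  (Equiv.subRight k).summable_iff.2 uK_sq_summable

lemma summable_mul_of_sq {ι : Type*} {f g : ι → ℝ} (hf : Summable (fun i => f i ^ 2))
    (hg : Summable (fun i => g i ^ 2)) : Summable (fun i => f i * g i) := by
  refine Summable.of_norm_bounded (hf.add hg) fun i => ?_
  rw [Real.norm_eq_abs, abs_le]
  constructor <;> nlinarith [sq_nonneg (f i + g i), sq_nonneg (f i - g i)]

lemma uK_mul_summable (d : ℤ) : Summable (fun n : ℤ => uK n * uK (n + d)) :=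
  summable_mul_of_sq uK_sq_summable ((Equiv.addRight d).summable_iff.2 uK_sq_summable)

lemma uK_identity (d n : ℤ) (hd : d ≠ 0) :
    uK n * uK (n + d) = (1 / (d : ℝ)) * (uK n - uK (n + d)) +
      (1 / (d : ℝ) ^ 2) * ((if n = 0 then 1 else 0) + (if n = -d then 1 else 0)) := by
  have hd' : (d : ℝ) ≠ 0 := by exact_mod_cast hd
  by_cases h0 : n = 0
  · subst h0
    have : ¬ (0 : ℤ) = -d := by omega
    simp [uK, this]
    field_simp
    ring
  by_cases h1 : n = -d
  · subst h1
    simp [uK, hd]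
    field_simp
    ring
  · have hn : (n : ℝ) ≠ 0 := by exact_mod_cast h0
    have hnd : (n : ℝ) + d ≠ 0 := by
      have : n + d ≠ 0 := by omega
      exact_mod_cast this
    simp [uK, h0, h1]
    field_simp
    ring

lemma hasSum_delta (a : ℤ) : HasSum (fun n : ℤ => if n = a then (1 : ℝ) else 0) 1 :=
  hasSum_ite_eq a 1

lemma uK_tele_one : HasSum (fun n : ℤ => uK n - uK (n + 1)) 0 := by
  have hs : Summable (fun n : ℤ => uK n - uK (n + 1)) := by
    have h1 := (uK_mul_summable 1).sub ((hasSum_delta 0).add (hasSum_delta (-1))).summable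
    refine h1.congr fun n => ?_
    rw [uK_identity 1 n one_ne_zero]
    push_cast
    ring
  have e : Function.Injective (fun n : ℕ => (n : ℤ)) := Nat.cast_injective
  have hT : Tendsto (fun n : ℕ => -uK (n : ℤ)) atTop (𝓝 0) := by
    have := tendsto_inv_atTop_nhds_zero_nat (𝕜 := ℝ)
    simpa [uK] using this.neg
  have h1 : HasSum (fun n : ℕ => uK (n : ℤ) - uK ((n : ℤ) + 1)) 0 := by
    have hs1 : Summable (fun n : ℕ => uK (n : ℤ) - uK ((n : ℤ) + 1)) :=
      hs.comp_injective e
    rw [hs1.hasSum_iff_tendsto_nat]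
    refine hT.congr fun N => ?_
    have := Finset.sum_range_sub' (fun n : ℕ => uK (n : ℤ)) N
    simp only [Nat.cast_add, Nat.cast_one, Nat.cast_zero, uK_zero] at this
    rw [this]; ring
  have h2 : HasSum (fun n : ℕ => uK (-((n : ℤ) + 1)) - uK (-((n : ℤ) + 1) + 1)) 0 := by
    refine h1.congr_fun ?_ 
    intro n
    rw [show -((n : ℤ) + 1) + 1 = -n by ring]
    simp only [uK, Int.cast_neg, inv_neg]
    ring
  simpa using HasSum.of_nat_of_neg_add_one (f := fun n : ℤ => uK n - uK (n + 1)) h1 h2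

lemma uK_tele (d : ℤ) : HasSum (fun n : ℤ => uK n - uK (n + d)) 0 := by
  have sh (e : ℤ) : HasSum (fun n : ℤ => uK (n + e) - uK (n + e + 1)) 0 :=
    (Equiv.addRight e).hasSum_iff.2 uK_tele_one
  induction d using Int.induction_on with
  | zero => simp
  | succ i ih =>
    have := ih.add (sh i)
    simp only [add_zero] at this
    convert! this using 2 with n
    rw [show n + ((i : ℤ) + 1) = n + i + 1 by ring]; ring
  | pred i ih =>
    have := ih.sub (sh (-i - 1))
    simp only [sub_zero] at this
    convert! this using 2 with n
    rw [show n + (-(i : ℤ) - 1) + 1 = n + -i by ring]; ring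

/-- The autocorrelation of the kernel. -/
noncomputable def cK (d : ℤ) : ℝ := ∑' n : ℤ, uK n * uK (n + d)

lemma cK_eq (d : ℤ) (hd : d ≠ 0) : cK d = 2 * uK d ^ 2 := by
  have h := ((uK_tele d).mul_left (1 / (d : ℝ))).add
    (((hasSum_delta 0).add (hasSum_delta (-d))).mul_left (1 / (d : ℝ) ^ 2))
  have : HasSum (fun n : ℤ => uK n * uK (n + d)) (1 / (d : ℝ) * 0 + 1 / (d : ℝ) ^ 2 * (1 + 1)) := by
    convert! h using 2 with n
    exact uK_identity d n hd
  rw [cK, this.tsum_eq, uK]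
  field_simp
  ring

lemma cK_summable : Summable (fun d : ℤ => |cK d|) := by
  have h := (uK_sq_summable.mul_left 2).add ((hasSum_delta 0).mul_left |cK 0|).summable
  refine Summable.of_nonneg_of_le (fun _ => abs_nonneg _) (fun d => ?_) h
  by_cases hd : d = 0
  · subst hd; simp [uK_zero]
  · rw [cK_eq d hd]; simp [hd]

lemma uK_corr (k j : ℤ) : HasSum (fun n : ℤ => uK (k - n) * uK (j - n)) (cK (j - k)) := by
  have h : HasSum (fun n : ℤ => uK n * uK (n + (j - k))) (cK (j - k)) :=
    (uK_mul_summable (j - k)).hasSum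
  have := (Equiv.subLeft k).hasSum_iff.2 h
  convert! this using 2 with n
  simp

lemma hilbert_fin_hasSum (x : ℤ → ℝ) (S : Finset ℤ) :
    HasSum (fun n : ℤ => (∑ k ∈ S, x k * uK (k - n)) ^ 2)
      (∑ k ∈ S, ∑ j ∈ S, x k * x j * cK (j - k)) := by
  have : HasSum (fun n : ℤ => ∑ k ∈ S, ∑ j ∈ S, x k * x j * (uK (k - n) * uK (j - n)))
      (∑ k ∈ S, ∑ j ∈ S, x k * x j * cK (j - k)) :=
    hasSum_sum fun k _ => hasSum_sum fun j _ => (uK_corr k j).mul_left _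
  refine this.congr_fun fun n => ?_
  rw [sq, Finset.sum_mul_sum]
  refine Finset.sum_congr rfl fun k _ => Finset.sum_congr rfl fun j _ => by ring

lemma cK_sum_le (S : Finset ℤ) (s : ℤ) : ∑ j ∈ S, |cK (j - s)| ≤ ∑' d, |cK d| := by
  have h2 : Summable (fun j : ℤ => |cK (j - s)|) := (Equiv.subRight s).summable_iff.2 cK_summable
  have h3 : ∑' j : ℤ, |cK (j - s)| = ∑' d, |cK d| :=
    (Equiv.subRight s).tsum_eq (fun d => |cK d|)
  rw [← h3]
  exact h2.sum_le_tsum _ fun _ _ => abs_nonneg _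

lemma cK_sum_le' (S : Finset ℤ) (s : ℤ) : ∑ j ∈ S, |cK (s - j)| ≤ ∑' d, |cK d| := by
  have h2 : Summable (fun j : ℤ => |cK (s - j)|) := (Equiv.subLeft s).summable_iff.2 cK_summable
  have h3 : ∑' j : ℤ, |cK (s - j)| = ∑' d, |cK d| :=
    (Equiv.subLeft s).tsum_eq (fun d => |cK d|)
  rw [← h3]
  exact h2.sum_le_tsum _ fun _ _ => abs_nonneg _

lemma schur_fin (x : ℤ → ℝ) (c : ℤ → ℝ) (C : ℝ) (S : Finset ℤ)
    (h1 : ∀ s, ∑ j ∈ S, |c (j - s)| ≤ C) (h2 : ∀ s, ∑ j ∈ S, |c (s - j)| ≤ C) :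
    ∑ k ∈ S, ∑ j ∈ S, x k * x j * c (j - k) ≤ C * ∑ k ∈ S, x k ^ 2 := by
  have e1 : ∑ k ∈ S, ∑ j ∈ S, x k * x j * c (j - k) ≤
      ∑ k ∈ S, ∑ j ∈ S, (x k ^ 2 / 2 * |c (j - k)| + x j ^ 2 / 2 * |c (j - k)|) := by
    refine Finset.sum_le_sum fun k _ => Finset.sum_le_sum fun j _ => ?_
    have a1 : x k * x j * c (j - k) ≤ |x k * x j| * |c (j - k)| := by
      rw [← abs_mul]; exact le_abs_self _
    have a2 : |x k * x j| ≤ x k ^ 2 / 2 + x j ^ 2 / 2 := by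
      rw [abs_le]
      constructor <;> nlinarith [sq_nonneg (x k + x j), sq_nonneg (x k - x j)]
    have a3 := mul_le_mul_of_nonneg_right a2 (abs_nonneg (c (j - k)))
    linarith
  have e2 : ∑ k ∈ S, ∑ j ∈ S, (x k ^ 2 / 2 * |c (j - k)| + x j ^ 2 / 2 * |c (j - k)|) =
      (∑ k ∈ S, x k ^ 2 / 2 * ∑ j ∈ S, |c (j - k)|) +
          ∑ j ∈ S, x j ^ 2 / 2 * ∑ k ∈ S, |c (j - k)| := by
    simp_rw [Finset.sum_add_distrib, Finset.mul_sum]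
    congr 1
    rw [Finset.sum_comm]
  have e3 : ∑ k ∈ S, x k ^ 2 / 2 * ∑ j ∈ S, |c (j - k)| ≤ ∑ k ∈ S, x k ^ 2 / 2 * C :=
    Finset.sum_le_sum fun k _ => mul_le_mul_of_nonneg_left (h1 k) (by positivity)
  have e4 : ∑ j ∈ S, x j ^ 2 / 2 * ∑ k ∈ S, |c (j - k)| ≤ ∑ k ∈ S, x k ^ 2 / 2 * C :=
    Finset.sum_le_sum fun k _ => mul_le_mul_of_nonneg_left (h2 k) (by positivity)
  have e5 : ∑ k ∈ S, x k ^ 2 / 2 * C = C / 2 * ∑ k ∈ S, x k ^ 2 := by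
    rw [Finset.mul_sum]
    exact Finset.sum_congr rfl fun k _ => by ring
  linarith

lemma hilbert_fin_s9 (x : ℤ → ℝ) (hx : Summable (fun k => x k ^ 2)) (S N : Finset ℤ) :
    ∑ n ∈ N, (∑ k ∈ S, x k * uK (k - n)) ^ 2 ≤ (∑' d, |cK d|) * ∑' k, x k ^ 2 := by
  have h1 := hilbert_fin_hasSum x S
  have hC0 : 0 ≤ ∑' d, |cK d| := tsum_nonneg fun _ => abs_nonneg _
  have hS : ∑ k ∈ S, x k ^ 2 ≤ ∑' k, x k ^ 2 := hx.sum_le_tsum _ fun _ _ => sq_nonneg _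
  have b1 := sum_le_hasSum N (fun _ _ => sq_nonneg _) h1
  have b2 := schur_fin x cK _ S (cK_sum_le S) (cK_sum_le' S)
  exact b1.trans (b2.trans (mul_le_mul_of_nonneg_left hS hC0))

/-- Boundedness of the discrete Hilbert transform on square summable sequences. -/
lemma hilbert (x : ℤ → ℝ) (hx : Summable (fun k => x k ^ 2)) :
    Summable (fun n : ℤ => (∑' k, x k * uK (k - n)) ^ 2) := by
  refine summable_of_sum_le (fun _ => sq_nonneg _) (c := (∑' d, |cK d|) * ∑' k, x k ^ 2) fun N => ?_
  have hT : Tendsto (fun S : Finset ℤ => ∑ n ∈ N, (∑ k ∈ S, x k * uK (k - n)) ^ 2) atTop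
      (𝓝 (∑ n ∈ N, (∑' k, x k * uK (k - n)) ^ 2)) := by
    refine tendsto_finsetSum _ fun n _ => Tendsto.pow ?_ 2
    exact (summable_mul_of_sq hx (uK_sq_summable_sub' n)).hasSum
  exact le_of_tendsto' hT fun S => hilbert_fin_s9 x hx S N

/-- Extension by zero of a sequence to the integers. -/
noncomputable def extZ (m : ℕ → ℝ) (k : ℤ) : ℝ := Function.extend (fun n : ℕ => (n : ℤ)) m 0 k

lemma extZ_nat (m : ℕ → ℝ) (k : ℕ) : extZ m (k : ℤ) = m k :=
  Nat.cast_injective.extend_apply m 0 k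

lemma extZ_other (m : ℕ → ℝ) (k : ℤ) (hk : k ∉ Set.range (fun n : ℕ => (n : ℤ))) :
    extZ m k = 0 := by
  rw [extZ, Function.extend_apply' _ _ _ (fun ⟨n, hn⟩ => hk ⟨n, hn⟩)]; rfl

lemma extZ_sq (m : ℕ → ℝ) (hm : Summable (fun k => m k ^ 2)) :
    Summable (fun k : ℤ => extZ m k ^ 2) := by
  have e : Function.Injective (fun n : ℕ => (n : ℤ)) := Nat.cast_injective
  rw [← e.summable_iff]
  · refine hm.congr fun k => ?_
    simp [extZ_nat]
  · intro k hk
    rw [extZ_other m k hk]; simp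

lemma extZ_tsum (m : ℕ → ℝ) (g : ℤ → ℝ) : ∑' k : ℤ, extZ m k * g k = ∑' k : ℕ, m k * g k := by
  have e : Function.Injective (fun n : ℕ => (n : ℤ)) := Nat.cast_injective
  rw [← e.tsum_eq]
  · refine tsum_congr fun k => ?_
    simp [extZ_nat]
  · intro k hk
    by_contra h
    rw [Function.mem_support, extZ_other m k h] at hk
    simp at hk

lemma hilbert_nat1 (m : ℕ → ℝ) (hm : Summable (fun k => m k ^ 2)) :
    Summable (fun n : ℕ => (∑' k : ℕ, m k * uK ((k : ℤ) - n)) ^ 2) := by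
  have e : Function.Injective (fun n : ℕ => (n : ℤ)) := Nat.cast_injective
  refine ((hilbert _ (extZ_sq m hm)).comp_injective e).congr fun n => ?_
  simp [extZ_tsum m (fun k => uK (k - n))]

lemma hilbert_nat2 (m : ℕ → ℝ) (hm : Summable (fun k => m k ^ 2)) :
    Summable (fun n : ℕ => (∑' k : ℕ, m k * uK ((k : ℤ) + n + 1)) ^ 2) := by
  have e : Function.Injective (fun n : ℕ => -((n : ℤ) + 1)) := by
    intro a b h; simp at h; exact h
  refine ((hilbert _ (extZ_sq m hm)).comp_injective e).congr fun n => ?_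
  have := extZ_tsum m (fun k => uK (k - (-((n : ℤ) + 1))))
  simp only [Function.comp]
  rw [this]
  simp only [sub_neg_eq_add, add_assoc]

/-- The diagonal type sum is summable. -/
lemma energy_summable (m : ℕ → ℝ) (hm : Summable (fun k => m k ^ 2)) :
    Summable (fun n : ℕ => ∑' k : ℕ, m k ^ 2 * uK ((k : ℤ) - n) ^ 2) := by
  have e : Function.Injective (fun n : ℕ => (n : ℤ)) := Nat.cast_injective
  have hin (k : ℕ) : Summable (fun n : ℕ => m k ^ 2 * uK ((k : ℤ) - n) ^ 2) :=
    ((uK_sq_summable_sub k).comp_injective e).mul_left _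
  have hle (k : ℕ) : ∑' n : ℕ, m k ^ 2 * uK ((k : ℤ) - n) ^ 2 ≤ m k ^ 2 * ∑' j, uK j ^ 2 := by
    rw [tsum_mul_left]
    gcongr
    have h3 : ∑' j : ℤ, uK ((k : ℤ) - j) ^ 2 = ∑' d, uK d ^ 2 :=
      (Equiv.subLeft (k : ℤ)).tsum_eq (fun d => uK d ^ 2)
    rw [← h3]
    exact tsum_comp_le_tsum_of_inj (uK_sq_summable_sub k) (fun _ => sq_nonneg _) e
  have hs : Summable (fun p : ℕ × ℕ => m p.1 ^ 2 * uK ((p.1 : ℤ) - p.2) ^ 2) := by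
    rw [summable_prod_of_nonneg (fun p => by positivity)]
    refine ⟨hin, ?_⟩
    refine Summable.of_nonneg_of_le (fun k => tsum_nonneg fun n => by positivity) hle ?_
    exact hm.mul_right _
  have h2 := ((Equiv.prodComm ℕ ℕ).summable_iff.2 hs)
  exact h2.prod

/-- The unperturbed points `π (k + 1/2)`. -/
noncomputable def aK (k : ℕ) : ℝ := π * ((k : ℝ) + 1 / 2)

lemma aK_pos (k : ℕ) : 0 < aK k := by unfold aK; positivity

lemma sin_aK (n : ℕ) : sin (aK n) = (-1) ^ n := by
  rw [aK, show π * ((n : ℝ) + 1 / 2) = π / 2 + n * π by ring, Real.sin_add_nat_mul_pi]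
  simp

lemma cos_aK (n : ℕ) : cos (aK n) = 0 := by
  rw [aK, show π * ((n : ℝ) + 1 / 2) = π / 2 + n * π by ring, Real.cos_add_nat_mul_pi]
  simp

lemma cos_eq_near (n : ℕ) (z : ℝ) : cos z = -((-1) ^ n * sin (z - aK n)) := by
  have : z = aK n + (z - aK n) := by ring
  conv_lhs => rw [this, Real.cos_add, sin_aK, cos_aK]
  ring

lemma sin_ne_near (n : ℕ) (z : ℝ) (hz : |z - aK n| < 1) : sin z ≠ 0 := by
  have : z = aK n + (z - aK n) := by ring
  rw [this, Real.sin_add, sin_aK, cos_aK]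
  have hc : 0 < cos (z - aK n) := by
    apply Real.cos_pos_of_mem_Ioo
    have := abs_lt.1 hz
    have := Real.pi_gt_three
    constructor <;> linarith
  have : ((-1 : ℝ)) ^ n ≠ 0 := by positivity
  simp [hc.ne']

lemma cos_prod_fin (z : ℝ) (N : ℕ) :
    (π * (2 * z / π) * ∏ j ∈ Finset.range (2 * N), ((1 : ℝ) - (2 * z / π) ^ 2 / ((j : ℝ) + 1) ^ 2)) =
    2 * (π * (z / π) * ∏ j ∈ Finset.range N, ((1 : ℝ) - (z / π) ^ 2 / ((j : ℝ) + 1) ^ 2)) *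
      ∏ k ∈ Finset.range N, (1 - z ^ 2 / aK k ^ 2) := by
  induction N with
  | zero => simp; ring
  | succ N ih =>
    rw [show 2 * (N + 1) = 2 * N + 1 + 1 by ring, Finset.prod_range_succ, Finset.prod_range_succ,
      Finset.prod_range_succ _ N, Finset.prod_range_succ _ N, ← mul_assoc, ← mul_assoc, ih]
    have h1 : (1 : ℝ) - (2 * z / π) ^ 2 / (((2 * N : ℕ) : ℝ) + 1) ^ 2 = 1 - z ^ 2 / aK N ^ 2 := by
      unfold aK
      push_cast
      have := Real.pi_pos
      have h2 : (2 * (N : ℝ) + 1) ≠ 0 := by positivity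
      have h3 : ((N : ℝ) + 1 / 2) ≠ 0 := by positivity
      field_simp
    have h2 : (1 : ℝ) - (2 * z / π) ^ 2 / (((2 * N + 1 : ℕ) : ℝ) + 1) ^ 2 =
        1 - (z / π) ^ 2 / ((N : ℝ) + 1) ^ 2 := by
      push_cast
      have := Real.pi_pos
      have h2 : (2 * (N : ℝ) + 1 + 1) ≠ 0 := by positivity
      have h3 : ((N : ℝ) + 1) ≠ 0 := by positivity
      field_simp
      ring
    rw [h1, h2]
    ring

lemma cos_prod_s9 (z : ℝ) (hz : sin z ≠ 0) :
    Tendsto (fun N : ℕ => ∏ k ∈ Finset.range N, (1 - z ^ 2 / aK k ^ 2)) atTop (𝓝 (cos z)) := by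
  have h1 := Real.tendsto_euler_sin_prod (z / π)
  have h2 := (Real.tendsto_euler_sin_prod (2 * z / π)).comp
    (tendsto_id.const_mul_atTop' (two_pos : (0 : ℕ) < 2))
  have e1 : π * (z / π) = z := by field_simp
  have e2 : π * (2 * z / π) = 2 * z := by field_simp
  rw [e1] at h1
  rw [e2] at h2
  have h3 := h2.div (h1.const_mul 2) (by simpa using hz)
  have e3 : sin (2 * z) / (2 * sin z) = cos z := by
    rw [Real.sin_two_mul]; field_simp
  rw [e3] at h3
  refine h3.congr' ?_
  have hne := h1.eventually_ne hz
  filter_upwards [hne] with N hN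
  have := cos_prod_fin z N
  rw [e1, e2] at this
  simp only [Pi.div_apply, Function.comp, id]
  rw [this]
  exact mul_div_cancel_left₀ _ (mul_ne_zero two_ne_zero hN)

/-- Factors (minus one) of the cosine product with the `n`-th factor removed. -/
noncomputable def hf (n k : ℕ) (z : ℝ) : ℝ := if k = n then 0 else -(z ^ 2 / aK k ^ 2)

/-- The cosine product with the `n`-th factor removed. -/
noncomputable def Qh (n : ℕ) (z : ℝ) : ℝ := ∏' k, (1 + hf n k z)

lemma aK_inv_summable : Summable (fun k : ℕ => 1 / aK k ^ 2) := by
  have h : Summable (fun k : ℕ => 1 / ((k : ℝ) + 1) ^ 2) := by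
    have := (summable_nat_add_iff 1).2 ((Real.summable_one_div_nat_pow (p := 2)).2 (by norm_num))
    simpa using this
  refine Summable.of_nonneg_of_le (fun k => by positivity) (fun k => ?_) h
  have : (k : ℝ) + 1 ≤ aK k := by
    unfold aK
    have hk : (0 : ℝ) ≤ k := by positivity
    nlinarith [Real.pi_gt_three]
  gcongr

lemma Qh_tendsto (n : ℕ) (z : ℝ) :
    Tendsto (fun N : ℕ => ∏ k ∈ Finset.range N, (1 + hf n k z)) atTop (𝓝 (Qh n z)) := by
  have hs : Summable (fun k => hf n k z) := by
    refine Summable.of_norm_bounded (aK_inv_summable.mul_left (z ^ 2)) fun k => ?_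
    unfold hf
    split_ifs
    · simp; positivity
    · rw [norm_neg, Real.norm_of_nonneg (by positivity)]
      apply le_of_eq; ring
  exact (Real.multipliable_one_add_of_summable hs).hasProd.tendsto_prod_nat

lemma Qh_cont (n : ℕ) (z : ℝ) : ContinuousAt (Qh n) z := by
  have h := Summable.hasProdUniformlyOn_nat_one_add (f := hf n) (K := Icc (z - 1) (z + 1))
    isCompact_Icc (u := fun k => ((|z| + 1) ^ 2) * (1 / aK k ^ 2)) (aK_inv_summable.mul_left _)
    (Eventually.of_forall fun k x hx => ?_) (fun k => ?_)
  · have h2 : ContinuousOn (Qh n) (Icc (z - 1) (z + 1)) := by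
      refine h.tendstoUniformlyOn_finsetRange.continuousOn ?_
      refine (Eventually.of_forall fun N => ?_).frequently
      refine continuousOn_finsetProd _ fun k _ => continuousOn_const.add ?_
      unfold hf
      split_ifs <;> fun_prop
    exact h2.continuousAt (Icc_mem_nhds (by linarith) (by linarith))
  · unfold hf
    split_ifs
    · simp; positivity
    · rw [norm_neg, Real.norm_of_nonneg (by positivity), div_eq_mul_one_div]
      have : |x| ≤ |z| + 1 := by
        rw [abs_le]
        constructor <;> linarith [hx.1, hx.2, neg_abs_le z, le_abs_self z]
      have h3 : x ^ 2 ≤ (|z| + 1) ^ 2 := by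
        rw [← sq_abs x]; gcongr
      gcongr
  · unfold hf
    split_ifs <;> fun_prop

lemma Qh_eq_ne (n : ℕ) (z : ℝ) (hz : |z - aK n| < 1) (hne : z ≠ aK n) :
    (z + aK n) / aK n ^ 2 * Qh n z = (-1) ^ n * sinc (z - aK n) := by
  have h1 := cos_prod_s9 z (sin_ne_near n z hz)
  have h2 := (Qh_tendsto n z).const_mul (1 - z ^ 2 / aK n ^ 2)
  have h3 : Tendsto (fun N : ℕ => ∏ k ∈ Finset.range N, (1 - z ^ 2 / aK k ^ 2)) atTop
      (𝓝 ((1 - z ^ 2 / aK n ^ 2) * Qh n z)) := by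
    refine h2.congr' ?_
    filter_upwards [eventually_gt_atTop n] with N hN
    have hn : n ∈ Finset.range N := Finset.mem_range.2 hN
    rw [← Finset.mul_prod_erase _ _ hn, ← Finset.mul_prod_erase _ _ hn]
    have : ∏ x ∈ (Finset.range N).erase n, (1 + hf n x z) =
        ∏ x ∈ (Finset.range N).erase n, (1 - z ^ 2 / aK x ^ 2) := by
      refine Finset.prod_congr rfl fun k hk => ?_
      rw [hf, if_neg (Finset.ne_of_mem_erase hk)]; ring
    rw [this]
    simp [hf]
  have h4 := tendsto_nhds_unique h1 h3
  have ha := (aK_pos n).ne'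
  rw [cos_eq_near n] at h4
  have h5 : z - aK n ≠ 0 := sub_ne_zero.2 hne
  rw [sinc_of_ne_zero h5, ← mul_div_assoc, eq_div_iff h5]
  have h6 : (-1) ^ n * sin (z - aK n) = -((1 - z ^ 2 / aK n ^ 2) * Qh n z) := by linarith
  rw [h6]
  field_simp
  ring

lemma Qh_eq (n : ℕ) (z : ℝ) (hz : |z - aK n| < 1) :
    (z + aK n) / aK n ^ 2 * Qh n z = (-1) ^ n * sinc (z - aK n) := by
  by_cases hne : z = aK n
  · subst hne
    have c1 : ContinuousAt (fun z => (z + aK n) / aK n ^ 2 * Qh n z) (aK n) :=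
      ContinuousAt.mul (by fun_prop) (Qh_cont n _)
    have c2 : ContinuousAt (fun z => (-1) ^ n * sinc (z - aK n)) (aK n) := by
      have := continuous_sinc
      fun_prop
    have t1 := c1.tendsto.mono_left (nhdsWithin_le_nhds (s := {aK n}ᶜ))
    have t2 := c2.tendsto.mono_left (nhdsWithin_le_nhds (s := {aK n}ᶜ))
    refine tendsto_nhds_unique_of_eventuallyEq t1 t2 ?_
    have : ∀ᶠ x in 𝓝[≠] (aK n), |x - aK n| < 1 := by
      apply eventually_nhdsWithin_of_eventually_nhds
      have := Metric.ball_mem_nhds (aK n) one_pos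
      filter_upwards [this] with x hx
      simpa [Real.dist_eq] using hx
    filter_upwards [this, self_mem_nhdsWithin] with x hx hx'
    exact Qh_eq_ne n x hx hx'
  · exact Qh_eq_ne n z hz hne

lemma sinc_sub_one (x : ℝ) (hx : |x| ≤ 1) : |sinc x - 1| ≤ |x| := by
  by_cases h0 : x = 0
  · simp [h0]
  have hb := Real.sin_bound hx
  rw [sinc_of_ne_zero h0]
  have hpos : 0 < |x| := abs_pos.2 h0
  have h1 : |sin x / x - 1| = |sin x - x| / |x| := by
    rw [← abs_div]; congr 1; field_simp
  rw [h1, div_le_iff₀ hpos]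
  have h2 : |sin x - x| ≤ |sin x - (x - x ^ 3 / 6)| + |x ^ 3 / 6| := by
    have := abs_sub (sin x - (x - x ^ 3 / 6)) (x ^ 3 / 6)
    rwa [show sin x - (x - x ^ 3 / 6) - x ^ 3 / 6 = sin x - x by ring] at this
  have h3 : |x ^ 3 / 6| = |x| ^ 3 / 6 := by rw [abs_div, abs_pow]; norm_num
  have h4 : |x| ^ 3 ≤ |x| ^ 2 := pow_le_pow_of_le_one hpos.le hx (by norm_num)
  have h5 : |x| ^ 4 ≤ |x| ^ 2 := pow_le_pow_of_le_one hpos.le hx (by norm_num)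
  nlinarith [sq_nonneg |x|]

lemma log_one_add_bound (x : ℝ) (hx : |x| ≤ 1 / 2) : |log (1 + x) - x| ≤ 2 * x ^ 2 := by
  have h := abs_le.1 hx
  have hp : 0 < 1 + x := by linarith
  have h1 := Real.log_le_sub_one_of_pos hp
  have h2 := Real.one_sub_inv_le_log_of_pos hp
  have h3 : x - 2 * x ^ 2 ≤ 1 - (1 + x)⁻¹ := by
    have : 1 - (1 + x)⁻¹ = x / (1 + x) := by field_simp; ring
    rw [this, le_div_iff₀ hp]
    nlinarith [sq_nonneg x]
  rw [abs_le]
  constructor <;> nlinarith [sq_nonneg x]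

lemma prod_fin_bound (s : Finset ℕ) (e : ℕ → ℝ) (he : ∀ k, |e k| ≤ 1 / 2)
    (hq : |∑ k ∈ s, e k| + 2 * ∑ k ∈ s, e k ^ 2 ≤ 1) :
    |∏ k ∈ s, (1 + e k) - 1| ≤ 2 * (|∑ k ∈ s, e k| + 2 * ∑ k ∈ s, e k ^ 2) := by
  have hp (k : ℕ) : 0 < 1 + e k := by have := abs_le.1 (he k); linarith
  have hlog : ∏ k ∈ s, (1 + e k) = exp (∑ k ∈ s, log (1 + e k)) := by
    rw [Real.exp_sum]
    exact Finset.prod_congr rfl fun k _ => (Real.exp_log (hp k)).symm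
  have hd : |∑ k ∈ s, log (1 + e k)| ≤ |∑ k ∈ s, e k| + 2 * ∑ k ∈ s, e k ^ 2 := by
    have h1 : ∑ k ∈ s, log (1 + e k) = ∑ k ∈ s, e k + ∑ k ∈ s, (log (1 + e k) - e k) := by
      rw [← Finset.sum_add_distrib]; simp
    rw [h1]
    refine (abs_add_le _ _).trans ?_
    gcongr
    refine (Finset.abs_sum_le_sum_abs _ _).trans ?_
    rw [Finset.mul_sum]
    exact Finset.sum_le_sum fun k _ => log_one_add_bound _ (he k)
  rw [hlog]
  refine (Real.abs_exp_sub_one_le (hd.trans hq)).trans ?_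
  gcongr

lemma prod_bound (e : ℕ → ℝ) (he : ∀ k, |e k| ≤ 1 / 2) (hs : Summable e)
    (hs2 : Summable (fun k => e k ^ 2)) (hq : |∑' k, e k| + 2 * ∑' k, e k ^ 2 < 1) :
    |∏' k, (1 + e k) - 1| ≤ 2 * (|∑' k, e k| + 2 * ∑' k, e k ^ 2) := by
  have t1 := (Real.multipliable_one_add_of_summable hs).hasProd.tendsto_prod_nat
  have t2 := hs.hasSum.tendsto_sum_nat.abs.add (hs2.hasSum.tendsto_sum_nat.const_mul 2)
  refine le_of_tendsto_of_tendsto (t1.sub_const 1).abs (t2.const_mul 2) ?_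
  filter_upwards [t2.eventually_lt_const hq] with N hN
  exact prod_fin_bound _ e he hN.le

lemma eps_bounds (a m l p q M : ℝ) (hp : 1 ≤ |p|) (hpq : |p| ≤ q) (hl : |l| ≤ 1) (hm : |m| ≤ M)
    (ha : 2 * a = π * p + π * q) :
    (π * p - l ≠ 0 ∧ π * q + l ≠ 0) ∧
    |m * (2 * a + m) / ((π * p - l) * (π * q + l))| ≤ (7 + M) * (|m| * |p⁻¹|) ∧
    |m * (2 * a + m) / ((π * p - l) * (π * q + l)) - (m * p⁻¹ + m * q⁻¹) / π| ≤
      (2 * M * |l| + m ^ 2) * p⁻¹ ^ 2 := by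
  have hpi := Real.pi_gt_three
  have hpi4 := Real.pi_lt_d2
  have hl' := abs_le.1 hl
  have hq : 1 ≤ q := hp.trans hpq
  have hp0 : p ≠ 0 := by intro h; simp [h] at hp; linarith
  have hpp : 0 < |p| := by linarith
  have hM : 0 ≤ M := (abs_nonneg m).trans hm
  have hX : 2 * |p| ≤ |π * p - l| := by
    have h1 : |π * p| - |l| ≤ |π * p - l| := abs_sub_abs_le_abs_sub _ _
    rw [abs_mul, abs_of_pos Real.pi_pos] at h1
    nlinarith
  have hY : 2 * q ≤ π * q + l := by nlinarith
  set X := π * p - l with hXd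
  set Y := π * q + l with hYd
  have hXpos : 0 < |X| := by linarith
  have hX0 : X ≠ 0 := abs_pos.1 hXpos
  have hY0 : 0 < Y := by linarith
  have h2a : |2 * a + m| ≤ (7 + M) * q := by
    refine (abs_add_le _ _).trans ?_
    rw [ha]
    have h1 : |π * p + π * q| ≤ π * |p| + π * q := by
      refine (abs_add_le _ _).trans ?_
      rw [abs_mul, abs_mul, abs_of_pos Real.pi_pos, abs_of_pos (by linarith : 0 < q)]
    nlinarith
  refine ⟨⟨hX0, hY0.ne'⟩, ?_, ?_⟩
  · rw [abs_div, abs_mul, abs_mul, abs_of_pos hY0, abs_inv, div_le_iff₀ (by positivity)]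
    have h1 : |p| * q ≤ |X| * Y := by
      apply mul_le_mul <;> linarith
    calc |m| * |2 * a + m| ≤ |m| * ((7 + M) * q) := by gcongr
      _ = (7 + M) * (|m| * |p|⁻¹) * (|p| * q) := by field_simp
      _ ≤ _ := by gcongr
  · have hq0 : q ≠ 0 := by linarith
    have e : m * (2 * a + m) / (X * Y) - (m * p⁻¹ + m * q⁻¹) / π =
        m * l / (X * (π * p)) - m * l / (Y * (π * q)) + m ^ 2 / (X * Y) := by
      have : 2 * a = X + Y := by rw [ha, hXd, hYd]; ring
      rw [this]
      have h1 : l = π * p - X := by rw [hXd]; ring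
      have h2 : m * l / (Y * (π * q)) = m * (Y - π * q) / (Y * (π * q)) := by rw [hYd]; ring_nf
      rw [h2, h1]
      have := Real.pi_ne_zero
      have := hY0.ne'
      clear_value X Y
      field_simp
      ring
    rw [e]
    have hpsq : p⁻¹ ^ 2 = (|p| * |p|)⁻¹ := by
      rw [abs_mul_abs_self, inv_pow, sq]
    have b1 : |m * l / (X * (π * p))| ≤ M * |l| * p⁻¹ ^ 2 := by
      rw [hpsq, abs_div, abs_mul, abs_mul, abs_mul, abs_of_pos Real.pi_pos, ← div_eq_mul_inv]
      have h1 : |p| * |p| ≤ |X| * (π * |p|) :=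
        mul_le_mul (by linarith) (by nlinarith) hpp.le hXpos.le
      exact div_le_div₀ (by positivity) (mul_le_mul_of_nonneg_right hm (abs_nonneg _))
        (by positivity) h1
    have b2 : |m * l / (Y * (π * q))| ≤ M * |l| * p⁻¹ ^ 2 := by
      rw [hpsq, abs_div, abs_mul, abs_mul, abs_mul, abs_of_pos Real.pi_pos, ← div_eq_mul_inv,
        abs_of_pos hY0, abs_of_pos (by linarith : 0 < q)]
      gcongr
      · linarith
      · nlinarith
    have b3 : |m ^ 2 / (X * Y)| ≤ m ^ 2 * p⁻¹ ^ 2 := by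
      rw [hpsq, abs_div, abs_mul, abs_of_pos hY0, abs_of_nonneg (sq_nonneg m), ← div_eq_mul_inv]
      have h1 : |p| * |p| ≤ |X| * Y :=
        mul_le_mul (by linarith) (by linarith) hpp.le hXpos.le
      exact div_le_div_of_nonneg_left (sq_nonneg _) (by positivity) h1
    have t1 := abs_add_le (m * l / (X * (π * p)) - m * l / (Y * (π * q))) (m ^ 2 / (X * Y))
    have t2 := abs_sub (m * l / (X * (π * p))) (m * l / (Y * (π * q)))
    linarith

/-- Relative perturbation of the `k`-th factor. -/
noncomputable def eK (mu : ℕ → ℝ) (z : ℝ) (n k : ℕ) : ℝ :=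
  if k = n then 0 else (mu k ^ 2 - aK k ^ 2) / (aK k ^ 2 - z ^ 2)

lemma eK_bounds (mu : ℕ → ℝ) (z M : ℝ) (n k : ℕ) (hk : k ≠ n) (hz : |z - aK n| ≤ 1)
    (hm : |mu k - aK k| ≤ M) :
    aK k ^ 2 - z ^ 2 ≠ 0 ∧
    |eK mu z n k| ≤ (7 + M) * (|mu k - aK k| * |uK ((k : ℤ) - n)|) ∧
    |eK mu z n k - ((mu k - aK k) * uK ((k : ℤ) - n) + (mu k - aK k) * uK ((k : ℤ) + n + 1)) / π| ≤
      (2 * M * |z - aK n| + (mu k - aK k) ^ 2) * uK ((k : ℤ) - n) ^ 2 := by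
  have hp : (1 : ℝ) ≤ |(k : ℝ) - n| := by
    have : (1 : ℤ) ≤ |(k : ℤ) - n| := Int.one_le_abs (by omega)
    exact_mod_cast this
  have hpq : |(k : ℝ) - n| ≤ (k : ℝ) + n + 1 := by
    have h1 : (0 : ℝ) ≤ k := by positivity
    have h2 : (0 : ℝ) ≤ n := by positivity
    rw [abs_le]; constructor <;> linarith
  obtain ⟨⟨h1, h2⟩, h3, h4⟩ := eps_bounds (aK k) (mu k - aK k) (z - aK n) ((k : ℝ) - n)
    ((k : ℝ) + n + 1) M hp hpq hz hm (by unfold aK; ring)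
  have e1 : π * ((k : ℝ) - n) - (z - aK n) = aK k - z := by unfold aK; ring
  have e2 : π * ((k : ℝ) + n + 1) + (z - aK n) = aK k + z := by unfold aK; ring
  rw [e1] at h1 h3 h4
  rw [e2] at h2 h3 h4
  have e3 : eK mu z n k = (mu k - aK k) * (2 * aK k + (mu k - aK k)) / ((aK k - z) * (aK k + z)) := by
    rw [eK, if_neg hk]
    congr 1 <;> ring
  have u1 : uK ((k : ℤ) - n) = ((k : ℝ) - n)⁻¹ := by simp [uK]
  have u2 : uK ((k : ℤ) + n + 1) = ((k : ℝ) + n + 1)⁻¹ := by simp [uK]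
  rw [u1, u2, e3]
  refine ⟨?_, h3, h4⟩
  rw [show aK k ^ 2 - z ^ 2 = (aK k - z) * (aK k + z) by ring]
  exact mul_ne_zero h1 h2

lemma uK_nat_summable (n : ℕ) : Summable (fun k : ℕ => uK ((k : ℤ) - n) ^ 2) :=
  (uK_sq_summable_sub' n).comp_injective (i := fun k : ℕ => (k : ℤ)) Nat.cast_injective

lemma uK_nat_le (n : ℕ) : ∑' k : ℕ, uK ((k : ℤ) - n) ^ 2 ≤ ∑' j, uK j ^ 2 := by
  have h3 : ∑' j : ℤ, uK (j - (n : ℤ)) ^ 2 = ∑' d, uK d ^ 2 :=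
    (Equiv.subRight (n : ℤ)).tsum_eq (fun d => uK d ^ 2)
  rw [← h3]
  exact tsum_comp_le_tsum_of_inj (uK_sq_summable_sub' n) (fun _ => sq_nonneg _)
    (i := fun k : ℕ => (k : ℤ)) Nat.cast_injective

lemma uK_nat_summable2 (n : ℕ) : Summable (fun k : ℕ => uK ((k : ℤ) + n + 1) ^ 2) := by
  have := (uK_sq_summable_sub' (-((n : ℤ) + 1))).comp_injective
    (i := fun k : ℕ => (k : ℤ)) Nat.cast_injective
  refine this.congr fun k => ?_
  simp only [Function.comp, sub_neg_eq_add, add_assoc]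

lemma abs_uK_le (j : ℤ) : |uK j| ≤ 1 := by
  by_cases h : j = 0
  · simp [h, uK_zero]
  · rw [uK, abs_inv]
    apply inv_le_one_of_one_le₀
    exact_mod_cast Int.one_le_abs h

/-- The square-summable majorant. -/
noncomputable def GK (m : ℕ → ℝ) (l : ℝ) (M : ℝ) (n : ℕ) : ℝ :=
  |∑' k : ℕ, m k * uK ((k : ℤ) - n)| + |∑' k : ℕ, m k * uK ((k : ℤ) + n + 1)| +
    (2 * M * ∑' j, uK j ^ 2) * |l| + |m n| +
    (1 + 2 * (7 + M) ^ 2) * ∑' k : ℕ, m k ^ 2 * uK ((k : ℤ) - n) ^ 2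

lemma energy_row (m : ℕ → ℝ) (hm : Summable (fun k => m k ^ 2)) (n : ℕ) :
    Summable (fun k : ℕ => m k ^ 2 * uK ((k : ℤ) - n) ^ 2) := by
  refine Summable.of_nonneg_of_le (fun k => by positivity) (fun k => ?_) hm
  have h1 := abs_uK_le ((k : ℤ) - n)
  have : uK ((k : ℤ) - n) ^ 2 ≤ 1 := by rw [← sq_abs]; exact pow_le_one₀ (abs_nonneg _) h1
  exact mul_le_of_le_one_right (sq_nonneg _) this

lemma R_bound (mu : ℕ → ℝ) (z M : ℝ) (n : ℕ) (hz : |z - aK n| ≤ 1)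
    (hM : ∀ k, |mu k - aK k| ≤ M) (hm : Summable (fun k => (mu k - aK k) ^ 2))
    (hG : GK (fun k => mu k - aK k) (z - aK n) M n < 1 / 2) :
    Summable (fun k => eK mu z n k) ∧
    |∏' k, (1 + eK mu z n k) - 1| ≤ 2 * GK (fun k => mu k - aK k) (z - aK n) M n := by
  set m : ℕ → ℝ := fun k => mu k - aK k with hmd
  have hM0 : 0 ≤ M := (abs_nonneg _).trans (hM 0)
  have hb1 (k : ℕ) : |eK mu z n k| ≤ (7 + M) * (|m k| * |uK ((k : ℤ) - n)|) := by
    by_cases hk : k = n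
    · rw [eK, if_pos hk, abs_zero]; positivity
    · exact (eK_bounds mu z M n k hk hz (hM k)).2.1
  have hrow := energy_row m hm n
  have s1 : Summable (fun k : ℕ => m k * uK ((k : ℤ) - n)) :=
    summable_mul_of_sq hm (uK_nat_summable n)
  have s2 : Summable (fun k : ℕ => m k * uK ((k : ℤ) + n + 1)) :=
    summable_mul_of_sq hm (uK_nat_summable2 n)
  have hs : Summable (fun k => eK mu z n k) := by
    refine Summable.of_norm_bounded (s1.abs.mul_left (7 + M)) fun k => ?_
    rw [abs_mul]; exact hb1 k
  have hsq (k : ℕ) : eK mu z n k ^ 2 ≤ (7 + M) ^ 2 * (m k ^ 2 * uK ((k : ℤ) - n) ^ 2) := by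
    have := pow_le_pow_left₀ (abs_nonneg _) (hb1 k) 2
    rw [sq_abs] at this
    refine this.trans (le_of_eq ?_)
    rw [mul_pow, mul_pow, sq_abs, sq_abs]
  have hs2 : Summable (fun k => eK mu z n k ^ 2) :=
    Summable.of_nonneg_of_le (fun _ => sq_nonneg _) hsq (hrow.mul_left _)
  set E := ∑' k : ℕ, m k ^ 2 * uK ((k : ℤ) - n) ^ 2 with hE
  have hE0 : 0 ≤ E := tsum_nonneg fun k => by positivity
  have hU0 : 0 ≤ ∑' j, uK j ^ 2 := tsum_nonneg fun k => by positivity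
  have hsum2 : ∑' k, eK mu z n k ^ 2 ≤ (7 + M) ^ 2 * E := by
    rw [hE, ← tsum_mul_left]
    exact hs2.tsum_le_tsum hsq (hrow.mul_left _)
  have hdiff (k : ℕ) : |eK mu z n k - (m k * uK ((k : ℤ) - n) + m k * uK ((k : ℤ) + n + 1)) / π| ≤
      (2 * M * |z - aK n|) * uK ((k : ℤ) - n) ^ 2 + m k ^ 2 * uK ((k : ℤ) - n) ^ 2 +
        (if k = n then |m n| else 0) := by
    by_cases hk : k = n
    · subst hk
      have := abs_uK_le ((k : ℤ) + k + 1)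
      simp only [eK, if_true, sub_self, uK_zero, mul_zero, zero_add, zero_sub, abs_neg]
      rw [abs_div, abs_mul, abs_of_pos Real.pi_pos]
      have h3 := Real.pi_gt_three
      have h4 : |m k| * |uK ((k : ℤ) + k + 1)| ≤ |m k| := mul_le_of_le_one_right (abs_nonneg _) this
      have h5 : |m k| * |uK ((k : ℤ) + k + 1)| / π ≤ |m k| := by
        rw [div_le_iff₀ Real.pi_pos]
        nlinarith [abs_nonneg (m k)]
      simpa using h5
    · have := (eK_bounds mu z M n k hk hz (hM k)).2.2
      rw [if_neg hk, add_zero, ← add_mul]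
      exact this
  have hdel : HasSum (fun k : ℕ => if k = n then |m n| else 0) |m n| := hasSum_ite_eq n _
  have sA := ((uK_nat_summable n).mul_left (2 * M * |z - aK n|))
  have sB := (sA.add hrow).add hdel.summable
  have hS : |∑' k, eK mu z n k - (∑' k : ℕ, m k * uK ((k : ℤ) - n) +
      ∑' k : ℕ, m k * uK ((k : ℤ) + n + 1)) / π| ≤
      (2 * M * |z - aK n|) * (∑' j, uK j ^ 2) + E + |m n| := by
    rw [← s1.tsum_add s2, ← tsum_div_const, ← hs.tsum_sub ((s1.add s2).div_const π)]
    have h1 : Summable (fun k => |eK mu z n k -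
        (m k * uK ((k : ℤ) - n) + m k * uK ((k : ℤ) + n + 1)) / π|) :=
      (hs.sub ((s1.add s2).div_const π)).abs
    have h2 := norm_tsum_le_tsum_norm (f := fun k => eK mu z n k -
        (m k * uK ((k : ℤ) - n) + m k * uK ((k : ℤ) + n + 1)) / π) h1
    simp only [Real.norm_eq_abs] at h2
    refine h2.trans ((h1.tsum_le_tsum hdiff sB).trans ?_)
    rw [(sA.add hrow).tsum_add hdel.summable, sA.tsum_add hrow, hdel.tsum_eq, tsum_mul_left]
    have := uK_nat_le n
    gcongr
  set T1 := ∑' k : ℕ, m k * uK ((k : ℤ) - n)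
  set T2 := ∑' k : ℕ, m k * uK ((k : ℤ) + n + 1)
  set U := ∑' j, uK j ^ 2
  have hGd : GK m (z - aK n) M n = |T1| + |T2| + (2 * M * U) * |z - aK n| + |m n| +
    (1 + 2 * (7 + M) ^ 2) * E := rfl
  have hT : |(T1 + T2) / π| ≤ |T1| + |T2| := by
    rw [abs_div, abs_of_pos Real.pi_pos, div_le_iff₀ Real.pi_pos]
    have h1 := abs_add_le T1 T2
    nlinarith [Real.pi_gt_three, abs_nonneg T1, abs_nonneg T2]
  have hSS : |∑' k, eK mu z n k| ≤ |T1| + |T2| + (2 * M * U) * |z - aK n| + |m n| + E := by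
    have := abs_add_le (∑' k, eK mu z n k - (T1 + T2) / π) ((T1 + T2) / π)
    rw [sub_add_cancel] at this
    nlinarith
  have hq : |∑' k, eK mu z n k| + 2 * ∑' k, eK mu z n k ^ 2 ≤ GK m (z - aK n) M n := by
    rw [hGd]; nlinarith
  have hEs : (7 + M) ^ 2 * E ≤ 1 / 4 := by
    have h1 := abs_nonneg T1
    have h2 := abs_nonneg T2
    have h3 := abs_nonneg (m n)
    have h4 : 0 ≤ (2 * M * U) * |z - aK n| := by positivity
    rw [hGd] at hG
    nlinarith
  have hhalf (k : ℕ) : |eK mu z n k| ≤ 1 / 2 := by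
    apply abs_le_of_sq_le_sq _ (by norm_num)
    have h1 : eK mu z n k ^ 2 ≤ ∑' k, eK mu z n k ^ 2 := hs2.le_tsum k fun _ _ => sq_nonneg _
    linarith
  refine ⟨hs, (prod_bound _ hhalf hs hs2 (by linarith)).trans ?_⟩
  linarith

lemma l2_add {f g : ℕ → ℝ} (hf : Summable (fun n => f n ^ 2)) (hg : Summable (fun n => g n ^ 2)) :
    Summable (fun n => (f n + g n) ^ 2) := by
  refine Summable.of_nonneg_of_le (fun _ => sq_nonneg _) (fun n => ?_) ((hf.add hg).mul_left 2)
  nlinarith [sq_nonneg (f n - g n)]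

lemma l2_abs {f : ℕ → ℝ} (hf : Summable (fun n => f n ^ 2)) :
    Summable (fun n => |f n| ^ 2) := by simpa using hf

lemma l2_mul {f : ℕ → ℝ} (c : ℝ) (hf : Summable (fun n => f n ^ 2)) :
    Summable (fun n => (c * f n) ^ 2) := by
  simp_rw [mul_pow]; exact hf.mul_left _

lemma l2_of_l1 {f : ℕ → ℝ} (h0 : ∀ n, 0 ≤ f n) (hf : Summable f) :
    Summable (fun n => f n ^ 2) := by
  refine Summable.of_norm_bounded_eventually_nat hf ?_
  filter_upwards [hf.tendsto_atTop_zero.eventually_lt_const one_pos] with n hn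
  rw [Real.norm_of_nonneg (sq_nonneg _)]
  nlinarith [h0 n]

lemma l2_tendsto {f : ℕ → ℝ} (hf : Summable (fun n => f n ^ 2)) :
    Tendsto (fun n => |f n|) atTop (𝓝 0) := by
  have := (hf.tendsto_atTop_zero).sqrt
  simpa [Real.sqrt_sq_eq_abs] using this

lemma GK_l2 (m l : ℕ → ℝ) (M : ℝ) (hm : Summable (fun n => m n ^ 2))
    (hl : Summable (fun n => l n ^ 2)) : Summable (fun n => GK m (l n) M n ^ 2) := by
  unfold GK
  refine l2_add (l2_add (l2_add (l2_add ?_ ?_) ?_) ?_) ?_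
  · exact l2_abs (hilbert_nat1 m hm)
  · exact l2_abs (hilbert_nat2 m hm)
  · exact l2_mul _ (l2_abs hl)
  · exact l2_abs hm
  · exact l2_mul _ (l2_of_l1 (fun n => tsum_nonneg fun k => by positivity) (energy_summable m hm))

lemma limit_eq (mu : ℕ → ℝ) (z M r : ℝ) (n : ℕ) (hz : |z - aK n| < 1)
    (hM : ∀ k, |mu k - aK k| ≤ M) (hs : Summable (fun k => eK mu z n k)) (hzp : 0 < z)
    (hr : Tendsto (fun N : ℕ => ∏ k ∈ Finset.range N, ((mu k ^ 2 - z ^ 2) / aK k ^ 2)) atTop (𝓝 r)) :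
    r = (z - mu n) * ((-1) ^ (n + 1) * (sinc (z - aK n) * (∏' k, (1 + eK mu z n k)) *
      (1 + (mu n - aK n) / (z + aK n)))) := by
  have t1 := (Real.multipliable_one_add_of_summable hs).hasProd.tendsto_prod_nat
  have t2 := ((Qh_tendsto n z).mul t1).const_mul ((mu n ^ 2 - z ^ 2) / aK n ^ 2)
  have t3 : Tendsto (fun N : ℕ => ∏ k ∈ Finset.range N, ((mu k ^ 2 - z ^ 2) / aK k ^ 2)) atTop
      (𝓝 ((mu n ^ 2 - z ^ 2) / aK n ^ 2 * (Qh n z * ∏' k, (1 + eK mu z n k)))) := by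
    refine t2.congr' ?_
    filter_upwards [eventually_gt_atTop n] with N hN
    have hn : n ∈ Finset.range N := Finset.mem_range.2 hN
    rw [← Finset.prod_mul_distrib, ← Finset.mul_prod_erase _ _ hn,
      ← Finset.mul_prod_erase _ (fun k => (mu k ^ 2 - z ^ 2) / aK k ^ 2) hn]
    have : ∏ x ∈ (Finset.range N).erase n, ((1 + hf n x z) * (1 + eK mu z n x)) =
        ∏ x ∈ (Finset.range N).erase n, ((mu x ^ 2 - z ^ 2) / aK x ^ 2) := by
      refine Finset.prod_congr rfl fun k hk => ?_
      have hk' := Finset.ne_of_mem_erase hk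
      have h0 := (eK_bounds mu z M n k hk' hz.le (hM k)).1
      have ha := (aK_pos k).ne'
      rw [hf, eK, if_neg hk', if_neg hk']
      field_simp
      ring
    rw [this]
    simp [hf, eK]
  rw [tendsto_nhds_unique hr t3]
  have hQ := Qh_eq n z hz
  have ha := aK_pos n
  have hza : z + aK n ≠ 0 := by positivity
  have e : (-1 : ℝ) ^ (n + 1) * (sinc (z - aK n) * (∏' k, (1 + eK mu z n k)) *
      (1 + (mu n - aK n) / (z + aK n))) = -(((-1) ^ n * sinc (z - aK n)) *
       (∏' k, (1 + eK mu z n k)) * (1 + (mu n - aK n) / (z + aK n))) := by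
    rw [pow_succ]; ring
  rw [e, ← hQ]
  field_simp
  ring

lemma three_bound (A R d α G β : ℝ) (hA : |A - 1| ≤ α) (hR : |R - 1| ≤ G) (hd : |d| ≤ β)
    (hα : α ≤ 1) (hG : G ≤ 1) : |A * R * (1 + d) - 1| ≤ 4 * (α + G + β) := by
  have hα0 := (abs_nonneg _).trans hA
  have hG0 := (abs_nonneg _).trans hR
  have hβ0 := (abs_nonneg _).trans hd
  have e : A * R * (1 + d) - 1 = (A - 1) * R + (R - 1) + A * R * d := by ring
  have hA' : |A| ≤ 2 := by
    have := abs_add_le (A - 1) 1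
    simp at this; linarith
  have hR' : |R| ≤ 2 := by
    have := abs_add_le (R - 1) 1
    simp at this; linarith
  rw [e]
  have t1 := abs_add_le ((A - 1) * R + (R - 1)) (A * R * d)
  have t2 := abs_add_le ((A - 1) * R) (R - 1)
  have t3 : |(A - 1) * R| ≤ α * 2 := by rw [abs_mul]; gcongr
  have t4 : |A * R * d| ≤ 2 * 2 * β := by rw [abs_mul, abs_mul]; gcongr
  linarith

/-- Sequences are indexed by `ℕ`, with index `n : ℕ` standing for the
subscript `n + 1`; thus `π (n - 1/2)` becomes `π (n + 1/2)`, `h/(π n)` becomes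
`h/(π (n+1))`, `ν_n/n` becomes `ν n/(n+1)`, and `(-1)ⁿ` becomes `(-1)^(n+1)`. -/
theorem Phi2_at_lam_asymptotics
    (lam mu : ℕ → ℝ) (hlampos : ∀ n, 0 < lam n) (hmupos : ∀ n, 0 < mu n)
    (hlam : Summable (fun n : ℕ => (lam n - π * ((n : ℝ) + 1 / 2)) ^ 2))
    (hmu : Summable (fun n : ℕ => (mu n - π * ((n : ℝ) + 1 / 2)) ^ 2))
    (hdist : Function.Injective (fun n : ℕ => mu n ^ 2))
    (h : ℝ) (ν : ℕ → ℝ) (hν : Summable (fun n : ℕ => (ν n) ^ 2))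
    (hdiff : ∀ n : ℕ, lam n - mu n = h / (π * ((n : ℝ) + 1)) + ν n / ((n : ℝ) + 1))
    (Φ₂ : ℂ → ℂ)
    (hΦ₂ : ∀ z : ℂ, Tendsto
      (fun N : ℕ => ∏ k ∈ Finset.range N,
        (((mu k : ℝ) : ℂ) ^ 2 - z ^ 2) / ((π : ℂ) ^ 2 * ((k : ℂ) + 1 / 2) ^ 2))
      atTop (𝓝 (Φ₂ z))) :
    ∃ muHat : ℕ → ℂ,
      Summable (fun n : ℕ => ‖muHat n‖ ^ 2) ∧
      ∀ n : ℕ, Φ₂ ((lam n : ℝ) : ℂ) =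
        ((lam n - mu n : ℝ) : ℂ) * ((-1 : ℂ) ^ (n + 1) + muHat n) := by
  have hl : Summable (fun n => (lam n - aK n) ^ 2) := hlam
  have hm : Summable (fun n => (mu n - aK n) ^ 2) := hmu
  -- the values are real
  have hreal (n : ℕ) : ∃ r : ℝ, Φ₂ ((lam n : ℝ) : ℂ) = (r : ℂ) ∧
      Tendsto (fun N : ℕ => ∏ k ∈ Finset.range N, ((mu k ^ 2 - lam n ^ 2) / aK k ^ 2)) atTop
        (𝓝 r) := by
    have h1 := hΦ₂ (lam n : ℂ)
    have h2 (N : ℕ) : ∏ k ∈ Finset.range N,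
        (((mu k : ℝ) : ℂ) ^ 2 - (lam n : ℂ) ^ 2) / ((π : ℂ) ^ 2 * ((k : ℂ) + 1 / 2) ^ 2) =
        ((∏ k ∈ Finset.range N, ((mu k ^ 2 - lam n ^ 2) / aK k ^ 2) : ℝ) : ℂ) := by
      rw [Complex.ofReal_prod]
      refine Finset.prod_congr rfl fun k _ => ?_
      unfold aK
      push_cast
      rw [mul_pow]
    simp_rw [h2] at h1
    have hre := (Complex.continuous_re.tendsto _).comp h1
    have him := (Complex.continuous_im.tendsto _).comp h1
    refine ⟨(Φ₂ (lam n : ℂ)).re, ?_, ?_⟩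
    · have him' : (Φ₂ (lam n : ℂ)).im = 0 := by
        refine tendsto_nhds_unique him ?_
        simp only [Function.comp_def, Complex.ofReal_im]
        exact tendsto_const_nhds
      apply Complex.ext <;> simp [him']
    · simpa only [Function.comp_def, Complex.ofReal_re] using hre
  choose r hrΦ hr using hreal
  -- a uniform bound
  obtain ⟨M, hM⟩ : ∃ M, ∀ k, |mu k - aK k| ≤ M := by
    obtain ⟨M, hM⟩ := (l2_tendsto hm).bddAbove_range
    exact ⟨M, fun k => hM ⟨k, rfl⟩⟩
  set G : ℕ → ℝ := fun n => GK (fun k => mu k - aK k) (lam n - aK n) M n with hGd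
  have hG2 : Summable (fun n => G n ^ 2) := GK_l2 _ (fun n => lam n - aK n) M hm hl
  have hbase (n : ℕ) (h0 : lam n = mu n) : Φ₂ ((lam n : ℝ) : ℂ) = 0 := by
    refine tendsto_nhds_unique (hΦ₂ _) (tendsto_const_nhds.congr' ?_)
    filter_upwards [eventually_gt_atTop n] with N hN
    rw [Finset.prod_eq_zero (Finset.mem_range.2 hN)]
    rw [h0]; simp
  refine ⟨fun n => if lam n = mu n then 0 else
    Φ₂ (lam n : ℂ) / ((lam n - mu n : ℝ) : ℂ) - (-1) ^ (n + 1), ?_, fun n => ?_⟩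
  · have hB : Summable (fun n => (4 * (|lam n - aK n| + 2 * G n + |mu n - aK n|)) ^ 2) :=
      l2_mul 4 (l2_add (l2_add (l2_abs hl) (l2_mul 2 hG2)) (l2_abs hm))
    refine Summable.of_norm_bounded_eventually_nat hB ?_
    filter_upwards [(l2_tendsto hl).eventually_lt_const one_pos,
      (l2_tendsto hG2).eventually_lt_const (by norm_num : (0 : ℝ) < 1 / 2)] with n hn1 hn2
    have hn3 : G n < 1 / 2 := (le_abs_self _).trans_lt hn2
    rw [Real.norm_of_nonneg (by positivity)]
    split_ifs with h0
    · simp; positivity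
    obtain ⟨hs, hR⟩ := R_bound mu (lam n) M n hn1.le hM hm hn3
    have hlim := limit_eq mu (lam n) M (r n) n hn1 hM hs (hlampos n) (hr n)
    have hsub : lam n - mu n ≠ 0 := sub_ne_zero.2 h0
    have hd : |(mu n - aK n) / (lam n + aK n)| ≤ |mu n - aK n| := by
      have h1 : 1 ≤ lam n + aK n := by
        have h2 : 1 ≤ aK n := by
          unfold aK
          have hk : (0 : ℝ) ≤ n := by positivity
          nlinarith [Real.pi_gt_three]
        linarith [hlampos n]
      rw [abs_div, abs_of_pos (by linarith : 0 < lam n + aK n)]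
      exact div_le_self (abs_nonneg _) h1
    have hfin := three_bound _ _ _ _ _ _ (sinc_sub_one _ hn1.le) hR hd hn1.le (by linarith)
    set W := sinc (lam n - aK n) * (∏' k, (1 + eK mu (lam n) n k)) *
      (1 + (mu n - aK n) / (lam n + aK n)) with hW
    have e : Φ₂ (lam n : ℂ) / ((lam n - mu n : ℝ) : ℂ) - (-1) ^ (n + 1) =
        (((-1) ^ (n + 1) * (W - 1) : ℝ) : ℂ) := by
      have e1 : (-1) ^ (n + 1) * (W - 1) = r n / (lam n - mu n) - (-1) ^ (n + 1) := by
        rw [hlim, mul_div_cancel_left₀ _ hsub]; ring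
      rw [e1, hrΦ n]
      push_cast
      rfl
    rw [e, Complex.norm_real, norm_mul, norm_pow, norm_neg, norm_one, one_pow, one_mul,
      Real.norm_eq_abs]
    exact pow_le_pow_left₀ (abs_nonneg _) hfin 2
  · by_cases h0 : lam n = mu n
    · rw [hbase n h0, h0]; simp
    · have hsub : ((lam n - mu n : ℝ) : ℂ) ≠ 0 := by
        exact_mod_cast sub_ne_zero.2 h0
      simp only [if_neg h0]
      rw [add_sub_cancel, mul_div_cancel₀ _ hsub]
end

section
/- Let (μ_k)_{k≥1}, (ν_k)_{k≥1} and (λ_n)_{n≥1} be sequences of positive real numbers such that (μ_k − π(k−1/2)), (ν_k − π(k−1/2)) and (λ_n − π(n−1/2)) are ℓ²-sequences, with (μ_k) and (ν_k) strictly increasing and the λ_n pairwise distinct. Define Φ(λ) := ∏_{k=1}^∞ (μ_k² − λ²)/(π²(k−1/2)²) and Φ̃(λ) := ∏_{k=1}^∞ (ν_k² − λ²)/(π²(k−1/2)²). If Φ(λ_n) = Φ̃(λ_n) for every n ≥ 1, then Φ(λ) = Φ̃(λ) for all λ ∈ ℂ and μ_k = ν_k for every k ≥ 1. -/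
open MeasureTheory Filter Real Set
open scoped Topology


namespace PFC

/-- The reference points. -/
noncomputable def P (k : ℕ) : ℝ := π * ((k : ℝ) + 1 / 2)

/-- The factors of the product. -/
noncomputable def fac (a : ℕ → ℝ) (k : ℕ) (z : ℂ) : ℂ :=
  (((a k : ℝ) : ℂ) ^ 2 - z ^ 2) / ((π : ℂ) ^ 2 * ((k : ℂ) + 1 / 2) ^ 2)

/-- The product. -/
noncomputable def Pr (a : ℕ → ℝ) (z : ℂ) : ℂ := ∏' k, fac a k z

lemma P_ge (k : ℕ) : 1 ≤ P k := by
  unfold P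
  have h : (0 : ℝ) ≤ k := Nat.cast_nonneg k
  nlinarith [Real.pi_gt_three]

lemma P_pos (k : ℕ) : 0 < P k := lt_of_lt_of_le one_pos (P_ge k)

lemma fac_eq (a : ℕ → ℝ) (k : ℕ) (z : ℂ) :
    fac a k z = (((a k : ℝ) : ℂ) ^ 2 - z ^ 2) / ((P k : ℝ) : ℂ) ^ 2 := by
  unfold fac P; push_cast; ring_nf

lemma summable_int : Summable (fun m : ℤ => 1 / ((m : ℝ) + 1 / 2) ^ 2) := by
  have h := (Real.summable_one_div_int_add_rpow (1 / 2) 2).2 (by norm_num)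
  refine h.congr fun m => ?_
  rw [Real.rpow_two, sq_abs]

lemma summable_P : Summable (fun k : ℕ => 1 / P k ^ 2) := by
  have h := summable_int.comp_injective (i := fun n : ℕ => (n : ℤ)) Nat.cast_injective
  refine (h.mul_left (1 / π ^ 2)).congr fun k => ?_
  simp only [Function.comp, P]
  push_cast
  rw [mul_pow]
  have : ((k : ℝ) + 1 / 2) ≠ 0 := by positivity
  field_simp

lemma summable_sq_sub (a : ℕ → ℝ) (ha : Summable fun k => (a k - P k) ^ 2) :
    Summable fun k => |a k ^ 2 - P k ^ 2| / P k ^ 2 := by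
  refine Summable.of_nonneg_of_le (fun k => by positivity) (fun k => ?_)
    ((ha.mul_left 2).add summable_P)
  have hP := P_ge k
  have hP0 := P_pos k
  rw [div_le_iff₀ (by positivity)]
  have e : (2 * (a k - P k) ^ 2 + 1 / P k ^ 2) * P k ^ 2
      = 2 * (a k - P k) ^ 2 * P k ^ 2 + 1 := by field_simp
  rw [e]
  have h1 : (a k - P k) ^ 2 ≤ (a k - P k) ^ 2 * P k ^ 2 := by
    nlinarith [sq_nonneg (a k - P k), mul_nonneg (sq_nonneg (a k - P k)) (sub_nonneg.2 hP), sq_nonneg (P k), mul_nonneg (sq_nonneg (a k - P k)) (by nlinarith : (0:ℝ) ≤ P k ^ 2 - 1)]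
  rw [abs_le]
  constructor
  · nlinarith [sq_nonneg ((a k - P k) * P k + 1), sq_nonneg (a k - P k)]
  · nlinarith [sq_nonneg ((a k - P k) * P k - 1)]

/-- Generic product lemma. -/
lemma generic (f : ℕ → ℂ → ℂ) (u : ℕ → ℝ) (hu : Summable u)
    (hf : ∀ k, Differentiable ℂ (f k))
    (hb : ∀ k z, ‖f k z - 1‖ ≤ u k * (1 + ‖z‖ ^ 2)) :
    (∀ z, Multipliable fun k => f k z) ∧
    Differentiable ℂ (fun z => ∏' k, f k z) ∧
    ∀ z, (∀ k, f k z ≠ 0) → ∏' k, f k z ≠ 0 := by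
  have hs : ∀ z, Summable fun k => ‖f k z - 1‖ := fun z =>
    Summable.of_nonneg_of_le (fun k => norm_nonneg _) (fun k => hb k z) (hu.mul_right _)
  have he : ∀ k z, 1 + (f k z - 1) = f k z := fun k z => by ring
  refine ⟨fun z => ?_, ?_, fun z hz => ?_⟩
  · simpa only [he] using multipliable_one_add_of_summable (hs z)
  · intro z
    have hu0 : ∀ k, 0 ≤ u k := fun k => by
      have := (norm_nonneg _).trans (hb k 0)
      simpa using this
    have H := Summable.hasProdLocallyUniformlyOn_nat_one_add (f := fun k z => f k z - 1)
      (K := Metric.ball (0 : ℂ) (‖z‖ + 1)) Metric.isOpen_ball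
      (hu.mul_right (1 + (‖z‖ + 1) ^ 2)) (Eventually.of_forall fun k x hx => by
        refine (hb k x).trans ?_
        have : ‖x‖ ≤ ‖z‖ + 1 := by simpa using (mem_ball_zero_iff.1 hx).le
        have := hu0 k
        gcongr) (fun k => ((hf k).sub_const 1).continuous.continuousOn)
    simp only [he] at H
    have hd := H.differentiableOn (.of_forall fun s => by
      have : Differentiable ℂ (fun z => ∏ k ∈ s, f k z) := by fun_prop
      simpa [Finset.prod_fn] using this.differentiableOn) Metric.isOpen_ball
    exact hd.differentiableAt (Metric.isOpen_ball.mem_nhds (by simp))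
  · simpa only [he] using tprod_one_add_ne_zero_of_summable (f := fun k => f k z - 1)
      (fun k => by rw [he]; exact hz k) (hs z)

/-- bounding sequence. -/
noncomputable def bd (a : ℕ → ℝ) (k : ℕ) : ℝ := |a k ^ 2 - P k ^ 2| / P k ^ 2 + 1 / P k ^ 2

lemma bd_nonneg (a : ℕ → ℝ) (k : ℕ) : 0 ≤ bd a k := by unfold bd; positivity

lemma summable_bd (a : ℕ → ℝ) (ha : Summable fun k => (a k - P k) ^ 2) : Summable (bd a) :=
  (summable_sq_sub a ha).add summable_P

lemma fac_bd (a : ℕ → ℝ) (k : ℕ) (z : ℂ) : ‖fac a k z - 1‖ ≤ bd a k * (1 + ‖z‖ ^ 2) := by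
  have hP0 := P_pos k
  have hc : ((P k : ℝ) : ℂ) ≠ 0 := by exact_mod_cast hP0.ne'
  have e : fac a k z - 1 = (((a k ^ 2 - P k ^ 2 : ℝ) : ℂ) - z ^ 2) / ((P k ^ 2 : ℝ) : ℂ) := by
    rw [fac_eq]; push_cast; field_simp; ring
  rw [e, norm_div, Complex.norm_real, Real.norm_of_nonneg (by positivity : 0 ≤ P k ^ 2)]
  rw [div_le_iff₀ (by positivity)]
  have h := norm_sub_le ((a k ^ 2 - P k ^ 2 : ℝ) : ℂ) (z ^ 2)
  rw [Complex.norm_real, Real.norm_eq_abs, norm_pow] at h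
  refine h.trans ?_
  have e2 : bd a k * (1 + ‖z‖ ^ 2) * P k ^ 2 = (|a k ^ 2 - P k ^ 2| + 1) * (1 + ‖z‖ ^ 2) := by
    unfold bd; field_simp
  rw [e2]
  nlinarith [abs_nonneg (a k ^ 2 - P k ^ 2), sq_nonneg ‖z‖, mul_nonneg (abs_nonneg (a k ^ 2 - P k ^ 2)) (sq_nonneg ‖z‖)]

lemma fac_diff (a : ℕ → ℝ) (k : ℕ) : Differentiable ℂ (fac a k) := by
  unfold fac; fun_prop


lemma fac_mult (a : ℕ → ℝ)
    (ha : Summable fun k => (a k - P k) ^ 2) (z : ℂ) : Multipliable fun k => fac a k z :=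
  (generic (fac a) (bd a) (summable_bd a ha) (fac_diff a) (fac_bd a)).1 z

lemma Pr_diff (a : ℕ → ℝ)
    (ha : Summable fun k => (a k - P k) ^ 2) : Differentiable ℂ (Pr a) :=
  (generic (fac a) (bd a) (summable_bd a ha) (fac_diff a) (fac_bd a)).2.1

lemma fac_zero (a : ℕ → ℝ) (k : ℕ) (z : ℂ) : fac a k z = 0 ↔ z ^ 2 = (a k : ℂ) ^ 2 := by
  have hc : ((P k : ℝ) : ℂ) ≠ 0 := by exact_mod_cast (P_pos k).ne'
  rw [fac_eq, div_eq_zero_iff, sub_eq_zero]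
  exact ⟨fun h => (h.resolve_right (pow_ne_zero _ hc)).symm, fun h => Or.inl h.symm⟩

lemma Pr_tendsto (a : ℕ → ℝ)
    (ha : Summable fun k => (a k - P k) ^ 2) (z : ℂ) : Tendsto (fun N : ℕ => ∏ k ∈ Finset.range N, fac a k z) atTop
    (𝓝 (Pr a z)) := (fac_mult a ha z).hasProd.tendsto_prod_nat

lemma Pr_split (a : ℕ → ℝ)
    (ha : Summable fun k => (a k - P k) ^ 2) (m : ℕ) : ∃ G : ℂ → ℂ, Differentiable ℂ G ∧ (∀ z, Pr a z = fac a m z * G z) ∧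
    ∀ z, (∀ k, k ≠ m → fac a k z ≠ 0) → G z ≠ 0 := by
  have H := generic (fun k z => if k = m then 1 else fac a k z) (bd a) (summable_bd a ha)
    (fun k => by
      by_cases h : k = m
      · simp [h]
      · simpa [h] using fac_diff a k)
    (fun k z => by
      by_cases h : k = m
      · simp only [h, if_true, sub_self, norm_zero]
        have := bd_nonneg a m
        positivity
      · simpa [h] using fac_bd a k z)
  refine ⟨_, H.2.1, fun z => ?_, fun z hz => H.2.2 z fun k => ?_⟩
  · refine Multipliable.tprod_eq_mul_tprod_ite' m ?_
    refine (H.1 z).congr fun k => ?_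
    by_cases h : k = m
    · subst h; simp
    · simp [h]
  · by_cases h : k = m
    · simp [h]
    · simpa [h] using hz k h

lemma Pr_zero (a : ℕ → ℝ)
    (ha : Summable fun k => (a k - P k) ^ 2) (z : ℂ) : Pr a z = 0 ↔ ∃ k, z ^ 2 = (a k : ℂ) ^ 2 := by
  constructor
  · intro h
    by_contra! hc
    exact (generic (fac a) (bd a) (summable_bd a ha) (fac_diff a) (fac_bd a)).2.2 z
      (fun k hk => hc k ((fac_zero a k z).1 hk)) h
  · rintro ⟨k, hk⟩
    obtain ⟨G, -, hG, -⟩ := Pr_split a ha k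
    rw [hG, (fac_zero a k z).2 hk, zero_mul]

lemma Pr_even (a : ℕ → ℝ) (z : ℂ) : Pr a (-z) = Pr a z := by
  simp [Pr, fac]

lemma Pr_deriv (a : ℕ → ℝ)
    (ha : Summable fun k => (a k - P k) ^ 2) (hpos : ∀ k, 0 < a k) (hinj : Function.Injective a) (z : ℂ) (hz : Pr a z = 0) :
    deriv (Pr a) z ≠ 0 := by
  obtain ⟨m, hm⟩ := (Pr_zero a ha z).1 hz
  obtain ⟨G, hGd, hG, hG0⟩ := Pr_split a ha m
  have hne : G z ≠ 0 := hG0 z fun k hk h => by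
    rw [fac_zero a, hm] at h
    have h' : a m ^ 2 = a k ^ 2 := by exact_mod_cast h
    exact hk (hinj ((pow_left_inj₀ (hpos m).le (hpos k).le two_ne_zero).1 h').symm)
  have e : Pr a = fun z => fac a m z * G z := funext hG
  have hz0 : z ≠ 0 := by
    rintro rfl
    have : (a m : ℂ) ≠ 0 := by exact_mod_cast (hpos m).ne'
    rw [zero_pow two_ne_zero] at hm
    exact pow_ne_zero 2 this hm.symm
  have hc : ((P m : ℝ) : ℂ) ≠ 0 := by exact_mod_cast (P_pos m).ne'
  have hd : HasDerivAt (fac a m) (-(2 * z) / ((P m : ℝ) : ℂ) ^ 2) z := by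
    have e2 : fac a m = fun z => (((a m : ℝ) : ℂ) ^ 2 - z ^ 2) / ((P m : ℝ) : ℂ) ^ 2 :=
      funext (fac_eq a m)
    rw [e2]
    simpa using ((hasDerivAt_pow 2 z).const_sub ((a m : ℂ) ^ 2)).div_const (((P m : ℝ) : ℂ) ^ 2)
  have hD := hd.mul (hGd z).hasDerivAt
  rw [(fac_zero a m z).2 hm, zero_mul, add_zero] at hD
  rw [e]
  have := hD.deriv
  change deriv (fun z => fac a m z * G z) z = _ at this
  rw [this]
  refine mul_ne_zero (div_ne_zero ?_ (pow_ne_zero _ hc)) hne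
  simpa using hz0


/-- Entire quotient. -/
lemma quotient (f g : ℂ → ℂ) (hf : Differentiable ℂ f) (hg : Differentiable ℂ g)
    (h0 : ∀ z, g z = 0 → f z = 0) (h1 : ∀ z, g z = 0 → deriv g z ≠ 0) :
    ∃ h : ℂ → ℂ, Differentiable ℂ h ∧ ∀ z, f z = g z * h z := by
  classical
  refine ⟨fun z => if g z = 0 then deriv f z / deriv g z else f z / g z, fun a => ?_, fun z => ?_⟩
  · by_cases ha : g a = 0
    · have hdf : Differentiable ℂ (dslope f a) := by
        rw [← differentiableOn_univ]
        exact (Complex.differentiableOn_dslope univ_mem).2 hf.differentiableOn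
      have hdg : Differentiable ℂ (dslope g a) := by
        rw [← differentiableOn_univ]
        exact (Complex.differentiableOn_dslope univ_mem).2 hg.differentiableOn
      have hga : dslope g a a ≠ 0 := by rw [dslope_same]; exact h1 a ha
      have hev : ∀ᶠ z in 𝓝 a, dslope g a z ≠ 0 := (hdg a).continuousAt.eventually_ne hga
      refine ((hdf a).div (hdg a) hga).congr_of_eventuallyEq ?_
      filter_upwards [hev] with z hz
      by_cases hza : z = a
      · subst hza; simp [ha]
      · have hfa := h0 a ha
        have e1 : dslope g a z = g z / (z - a) := by
          rw [dslope_of_ne _ hza, slope_def_field, ha, sub_zero]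
        have e2 : dslope f a z = f z / (z - a) := by
          rw [dslope_of_ne _ hza, slope_def_field, hfa, sub_zero]
        have hza' : z - a ≠ 0 := sub_ne_zero.2 hza
        have hgz : g z ≠ 0 := by
          intro h; rw [e1, h] at hz; simp at hz
        simp only [hgz, if_false, Pi.div_apply, e1, e2]
        field_simp
    · refine ((hf a).div (hg a) ha).congr_of_eventuallyEq ?_
      filter_upwards [(hg a).continuousAt.eventually_ne ha] with z hz
      simp [hz]
  · by_cases hz : g z = 0
    · simp [hz, h0 z hz]
    · simp only [hz, if_false]; field_simp

/-- Comparison of two products. -/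
lemma compare (a b : ℕ → ℝ) (ha : Summable fun k => (a k - P k) ^ 2)
    (hb : Summable fun k => (b k - P k) ^ 2) (z : ℂ) (S : ℝ)
    (hz : ∀ k, (b k : ℂ) ^ 2 - z ^ 2 ≠ 0)
    (hS : ∀ M, ∑ k ∈ Finset.range M, |a k ^ 2 - b k ^ 2| / ‖(b k : ℂ) ^ 2 - z ^ 2‖ ≤ S) :
    ‖Pr a z - Pr b z‖ ≤ (Real.exp S - 1) * ‖Pr b z‖ := by
  refine le_of_tendsto_of_tendsto' (((Pr_tendsto a ha z).sub (Pr_tendsto b hb z)).norm)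
    ((Pr_tendsto b hb z).norm.const_mul _) fun M => ?_
  set q : ℕ → ℂ := fun k => ((a k ^ 2 - b k ^ 2 : ℝ) : ℂ) / ((b k : ℂ) ^ 2 - z ^ 2) with hq
  have e : ∀ k, fac a k z = fac b k z * (1 + q k) := fun k => by
    have hc : ((P k : ℝ) : ℂ) ≠ 0 := by exact_mod_cast (P_pos k).ne'
    have := hz k
    rw [fac_eq, fac_eq, hq]
    push_cast
    field_simp
    ring
  have hb := Finset.norm_prod_one_add_sub_one_le (Finset.range M) q
  have hs : ∑ k ∈ Finset.range M, ‖q k‖ ≤ S := by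
    refine le_trans (le_of_eq ?_) (hS M)
    refine Finset.sum_congr rfl fun k _ => ?_
    rw [hq, norm_div, Complex.norm_real, Real.norm_eq_abs]
  simp only [e, Finset.prod_mul_distrib]
  rw [← mul_sub_one, norm_mul, mul_comm]
  refine mul_le_mul_of_nonneg_right (hb.trans ?_) (norm_nonneg _)
  gcongr

lemma dev_bound (b : ℕ → ℝ) (hb : Summable fun k => (b k - P k) ^ 2) :
    ∃ C : ℝ, 0 ≤ C ∧ ∀ k, |b k - P k| ≤ C := by
  refine ⟨1 + ∑' k, (b k - P k) ^ 2, by positivity, fun k => ?_⟩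
  have h := hb.le_tsum k (fun j _ => sq_nonneg _)
  have h2 : |b k - P k| ≤ 1 + (b k - P k) ^ 2 := by
    rw [← sq_abs (b k - P k)]
    nlinarith [sq_nonneg (|b k - P k| - 1), abs_nonneg (b k - P k)]
  linarith

lemma circle (a b : ℕ → ℝ) (ha : Summable fun k => (a k - P k) ^ 2)
    (hb : Summable fun k => (b k - P k) ^ 2) (hapos : ∀ k, 0 < a k) (hbpos : ∀ k, 0 < b k) :
    ∃ S : ℝ, ∃ N0 : ℕ, ∀ N : ℕ, N0 ≤ N → ∀ z : ℂ, ‖z‖ = π * N →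
      (∀ k, (b k : ℂ) ^ 2 - z ^ 2 ≠ 0) ∧
      ∀ M, ∑ k ∈ Finset.range M, |a k ^ 2 - b k ^ 2| / ‖(b k : ℂ) ^ 2 - z ^ 2‖ ≤ S := by
  obtain ⟨Ca, hCa0, hCa⟩ := dev_bound a ha
  obtain ⟨Cb, hCb0, hCb⟩ := dev_bound b hb
  have hev : ∀ᶠ k in atTop, (b k - P k) ^ 2 < (1 / 2) ^ 2 :=
    hb.tendsto_atTop_zero.eventually_lt_const (by norm_num)
  obtain ⟨K, hK⟩ := eventually_atTop.1 hev
  obtain ⟨L, hL⟩ := exists_nat_ge Cb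
  have hδ : Summable fun k => (a k - b k) ^ 2 := by
    refine Summable.of_nonneg_of_le (fun k => sq_nonneg _) (fun k => ?_)
      ((ha.mul_left 2).add (hb.mul_left 2))
    nlinarith [sq_nonneg ((a k - P k) + (b k - P k))]
  set A : ℝ := 2 + (Ca + Cb) with hA
  refine ⟨A * (∑' k, (a k - b k) ^ 2 + ∑' m : ℤ, 1 / ((m : ℝ) + 1 / 2) ^ 2), K + L + 1,
    fun N hN z hz => ?_⟩
  have hN' : (K : ℝ) + L + 1 ≤ N := by exact_mod_cast hN
  have hpi := Real.pi_gt_three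
  have key : ∀ k : ℕ, 1 / 2 ≤ |(k : ℝ) + 1 / 2 - N| ∧
      |(k : ℝ) + 1 / 2 - N| * (b k + π * N) ≤ ‖(b k : ℂ) ^ 2 - z ^ 2‖ := by
    intro k
    have hd : 1 / 2 ≤ |(k : ℝ) + 1 / 2 - N| := by
      rcases le_or_gt N k with h | h
      · have : (N : ℝ) ≤ k := by exact_mod_cast h
        refine le_trans ?_ (le_abs_self _); linarith
      · have : (k : ℝ) + 1 ≤ N := by exact_mod_cast h
        refine le_trans ?_ (neg_le_abs _); linarith
    refine ⟨hd, ?_⟩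
    have hε : |b k - P k| ≤ |(k : ℝ) + 1 / 2 - N| := by
      rcases le_or_gt K k with h | h
      · have := abs_lt_of_sq_lt_sq (hK k h) (by norm_num)
        linarith
      · have : (k : ℝ) + 1 ≤ K := by exact_mod_cast h
        have h2 := neg_le_abs ((k : ℝ) + 1 / 2 - N)
        linarith [hCb k]
    have h1 : |(k : ℝ) + 1 / 2 - N| ≤ |b k - π * N| := by
      have e : π * ((k : ℝ) + 1 / 2 - N) = (b k - π * N) - (b k - P k) := by
        unfold P; ring
      have h3 := abs_sub (b k - π * N) (b k - P k)
      rw [← e, abs_mul, abs_of_pos Real.pi_pos] at h3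
      nlinarith
    have h2 : |b k ^ 2 - (π * N) ^ 2| ≤ ‖(b k : ℂ) ^ 2 - z ^ 2‖ := by
      have := abs_norm_sub_norm_le ((b k : ℂ) ^ 2) (z ^ 2)
      rwa [norm_pow, norm_pow, hz, Complex.norm_real, Real.norm_of_nonneg (hbpos k).le] at this
    have h4 : 0 < b k + π * N := by have := hbpos k; positivity
    refine le_trans ?_ h2
    rw [sq_sub_sq, abs_mul, abs_of_pos h4, mul_comm]
    gcongr
  have hpos : ∀ k : ℕ, 0 < |(k : ℝ) + 1 / 2 - N| * (b k + π * N) := fun k => by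
    have h1 := (key k).1
    have := hbpos k
    have : 0 < |(k : ℝ) + 1 / 2 - N| := by linarith
    positivity
  refine ⟨fun k h => ?_, fun M => ?_⟩
  · have := (key k).2
    rw [h, norm_zero] at this
    linarith [hpos k]
  · have hterm : ∀ k : ℕ, |a k ^ 2 - b k ^ 2| / ‖(b k : ℂ) ^ 2 - z ^ 2‖ ≤
        A * ((a k - b k) ^ 2 + 1 / ((((k : ℤ) - (N : ℤ) : ℤ) : ℝ) + 1 / 2) ^ 2) := by
      intro k
      obtain ⟨hd, hk⟩ := key k
      have hbk := hbpos k
      have hak := hapos k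
      have hd0 : 0 < |(k : ℝ) + 1 / 2 - N| := by linarith
      have hN1 : (1 : ℝ) ≤ N := by
        have : (0 : ℝ) ≤ K := Nat.cast_nonneg _
        have : (0 : ℝ) ≤ L := Nat.cast_nonneg _
        linarith
      have hs0 : 0 < b k + π * N := by positivity
      have e : (((k : ℤ) - (N : ℤ) : ℤ) : ℝ) + 1 / 2 = (k : ℝ) + 1 / 2 - N := by
        push_cast; ring
      rw [e, ← sq_abs (a k - b k), ← sq_abs ((k : ℝ) + 1 / 2 - N)]
      set d := |(k : ℝ) + 1 / 2 - N| with hdd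
      have hab : |a k - b k| ≤ Ca + Cb := by
        have := abs_sub (a k - P k) (b k - P k)
        rw [sub_sub_sub_cancel_right] at this
        linarith [hCa k, hCb k]
      have hsum : a k + b k ≤ A * (b k + π * N) := by
        have := le_abs_self (a k - b k)
        have h1 : 1 ≤ b k + π * N := by nlinarith
        have : Ca + Cb ≤ (Ca + Cb) * (b k + π * N) := by
          nlinarith [add_nonneg hCa0 hCb0]
        have : 0 ≤ π * N := by positivity
        rw [hA]; nlinarith
      have hA0 : 0 ≤ A := by rw [hA]; positivity
      calc |a k ^ 2 - b k ^ 2| / ‖(b k : ℂ) ^ 2 - z ^ 2‖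
          ≤ (|a k - b k| * (A * (b k + π * N))) / (d * (b k + π * N)) := by
            rw [sq_sub_sq, abs_mul, abs_of_pos (by positivity : 0 < a k + b k), mul_comm]
            gcongr
        _ = A * (|a k - b k| * (1 / d)) := by field_simp
        _ ≤ A * (|a k - b k| ^ 2 + 1 / d ^ 2) := by
            refine mul_le_mul_of_nonneg_left ?_ hA0
            have : 1 / d ^ 2 = (1 / d) ^ 2 := by rw [div_pow, one_pow]
            rw [this]
            nlinarith [sq_nonneg (|a k - b k| - 1 / d), sq_nonneg (|a k - b k|), sq_nonneg (1 / d)]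
    refine (Finset.sum_le_sum fun k _ => hterm k).trans ?_
    rw [← Finset.mul_sum, Finset.sum_add_distrib]
    have hA0 : 0 ≤ A := by rw [hA]; positivity
    refine mul_le_mul_of_nonneg_left (add_le_add ?_ ?_) hA0
    · exact hδ.sum_le_tsum _ (fun _ _ => sq_nonneg _)
    · have hinj : Function.Injective (fun k : ℕ => (k : ℤ) - (N : ℤ)) := fun x y h => by
        simpa using h
      have := Finset.sum_image (s := Finset.range M) (g := fun k : ℕ => (k : ℤ) - (N : ℤ))
        (f := fun m : ℤ => 1 / ((m : ℝ) + 1 / 2) ^ 2) (fun x _ y _ h => hinj h)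
      rw [← this]
      exact summable_int.sum_le_tsum _ (fun _ _ => by positivity)

lemma imag (a b : ℕ → ℝ) (ha : Summable fun k => (a k - P k) ^ 2)
    (hb : Summable fun k => (b k - P k) ^ 2) (hbpos : ∀ k, 0 < b k) :
    ∀ η : ℝ, 0 < η → ∀ᶠ y : ℝ in atTop,
      ‖Pr a (y * Complex.I) - Pr b (y * Complex.I)‖ ≤ η * ‖Pr b (y * Complex.I)‖ := by
  intro η hη
  obtain ⟨C, hC0, hC⟩ := dev_bound b hb
  have hsum : Summable fun k => 2 * (|a k ^ 2 - P k ^ 2| / P k ^ 2 + |b k ^ 2 - P k ^ 2| / P k ^ 2) :=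
    ((summable_sq_sub a ha).add (summable_sq_sub b hb)).mul_left 2
  have hle : ∀ y : ℝ, C ≤ y → ∀ k, |a k ^ 2 - b k ^ 2| / (b k ^ 2 + y ^ 2) ≤
      2 * (|a k ^ 2 - P k ^ 2| / P k ^ 2 + |b k ^ 2 - P k ^ 2| / P k ^ 2) := by
    intro y hy k
    have hP := P_pos k
    have hbk := hbpos k
    have h1 : |a k ^ 2 - b k ^ 2| ≤ |a k ^ 2 - P k ^ 2| + |b k ^ 2 - P k ^ 2| := by
      have := abs_sub (a k ^ 2 - P k ^ 2) (b k ^ 2 - P k ^ 2)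
      rwa [sub_sub_sub_cancel_right] at this
    have h2 : P k ^ 2 / 2 ≤ b k ^ 2 + y ^ 2 := by
      have h3 : (b k - P k) ^ 2 ≤ y ^ 2 := by
        rw [← sq_abs (b k - P k)]
        exact pow_le_pow_left₀ (abs_nonneg _) ((hC k).trans hy) 2
      nlinarith [sq_nonneg (b k + (b k - P k))]
    calc |a k ^ 2 - b k ^ 2| / (b k ^ 2 + y ^ 2)
        ≤ (|a k ^ 2 - P k ^ 2| + |b k ^ 2 - P k ^ 2|) / (P k ^ 2 / 2) := by gcongr
      _ = _ := by field_simp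
  have ht : Tendsto (fun y : ℝ => ∑' k, |a k ^ 2 - b k ^ 2| / (b k ^ 2 + y ^ 2)) atTop
      (𝓝 (∑' _ : ℕ, (0 : ℝ))) := by
    refine tendsto_tsum_of_dominated_convergence hsum (fun k => ?_) ?_
    · refine Tendsto.div_atTop tendsto_const_nhds ?_
      exact tendsto_atTop_add_const_left _ _ (tendsto_pow_atTop two_ne_zero)
    · filter_upwards [eventually_ge_atTop C] with y hy k
      rw [Real.norm_of_nonneg (by positivity)]
      exact hle y hy k
  rw [tsum_zero] at ht
  have ht2 : Tendsto (fun y : ℝ => Real.exp (∑' k, |a k ^ 2 - b k ^ 2| / (b k ^ 2 + y ^ 2)) - 1)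
      atTop (𝓝 0) := by
    have := ((Real.continuous_exp.tendsto 0).comp ht).sub_const 1
    simpa using this
  filter_upwards [ht2.eventually_lt_const hη, eventually_ge_atTop C] with y hy hyC
  have e : ∀ k, (b k : ℂ) ^ 2 - (y * Complex.I) ^ 2 = ((b k ^ 2 + y ^ 2 : ℝ) : ℂ) := fun k => by
    rw [mul_pow, Complex.I_sq]; push_cast; ring
  have hp : ∀ k, 0 < b k ^ 2 + y ^ 2 := fun k => by have := hbpos k; positivity
  refine (compare a b ha hb (y * Complex.I) _ (fun k => ?_) (fun M => ?_)).trans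
    (mul_le_mul_of_nonneg_right hy.le (norm_nonneg _))
  · rw [e]; exact_mod_cast (hp k).ne'
  · have e2 : ∀ k, ‖(b k : ℂ) ^ 2 - (y * Complex.I) ^ 2‖ = b k ^ 2 + y ^ 2 := fun k => by
      rw [e, Complex.norm_real, Real.norm_of_nonneg (hp k).le]
    simp only [e2]
    exact (Summable.of_nonneg_of_le (fun k => by positivity) (hle y hyC) hsum).sum_le_tsum _
      (fun k _ => by positivity)

lemma main_eq (a c b : ℕ → ℝ) (ha : Summable fun k => (a k - P k) ^ 2)
    (hc : Summable fun k => (c k - P k) ^ 2)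
    (hb : Summable fun k => (b k - P k) ^ 2) (hapos : ∀ k, 0 < a k) (hcpos : ∀ k, 0 < c k)
    (hbpos : ∀ k, 0 < b k) (hinj : Function.Injective b)
    (heq : ∀ n, Pr a (b n) = Pr c (b n)) (z : ℂ) : Pr a z = Pr c z := by
  obtain ⟨h, hh, hD⟩ := quotient (fun z => Pr a z - Pr c z) (Pr b)
    ((Pr_diff a ha).sub (Pr_diff c hc)) (Pr_diff b hb) (fun z hz => by
      obtain ⟨k, hk⟩ := (Pr_zero b hb z).1 hz
      rcases sq_eq_sq_iff_eq_or_eq_neg.1 hk with rfl | rfl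
      · simp [heq]
      · simp [Pr_even, heq]) (Pr_deriv b hb hbpos hinj)
  have hnorm : ∀ z B, Pr b z ≠ 0 → ‖Pr a z - Pr b z‖ ≤ B * ‖Pr b z‖ → ∀ B',
      ‖Pr c z - Pr b z‖ ≤ B' * ‖Pr b z‖ → ‖h z‖ ≤ B + B' := by
    intro z B hz h1 B' h2
    have h3 : ‖Pr b z‖ * ‖h z‖ ≤ (B + B') * ‖Pr b z‖ := by
      rw [← norm_mul, ← hD z]
      have := norm_sub_le (Pr a z - Pr b z) (Pr c z - Pr b z)
      rw [sub_sub_sub_cancel_right] at this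
      linarith
    have h4 : 0 < ‖Pr b z‖ := norm_pos_iff.2 hz
    rw [mul_comm] at h3
    exact le_of_mul_le_mul_right h3 h4
  obtain ⟨S1, N1, H1⟩ := circle a b ha hb hapos hbpos
  obtain ⟨S2, N2, H2⟩ := circle c b hc hb hcpos hbpos
  have hbd : ∀ w, ‖h w‖ ≤ (Real.exp S1 - 1) + (Real.exp S2 - 1) := by
    intro w
    obtain ⟨L, hL⟩ := exists_nat_gt ‖w‖
    set N := N1 + N2 + L + 1 with hN
    have hNR : ‖w‖ < π * N := by
      have h1 : (L : ℝ) ≤ N := by exact_mod_cast (by omega : L ≤ N)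
      nlinarith [Real.pi_gt_three, norm_nonneg w]
    have hR : (π * N : ℝ) ≠ 0 := by linarith [norm_nonneg w]
    refine Complex.norm_le_of_forall_mem_frontier_norm_le (U := Metric.ball (0 : ℂ) (π * N))
      Metric.isBounded_ball hh.diffContOnCl (fun x hx => ?_) (subset_closure (by simpa using hNR))
    rw [frontier_ball _ hR] at hx
    have hx' : ‖x‖ = π * N := by simpa using hx
    obtain ⟨p1, p2⟩ := H1 N (by omega) x hx'
    obtain ⟨q1, q2⟩ := H2 N (by omega) x hx'
    refine hnorm x _ (fun h0 => ?_) (compare a b ha hb x S1 p1 p2) _ (compare c b hc hb x S2 q1 q2)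
    obtain ⟨k, hk⟩ := (Pr_zero b hb x).1 h0
    exact p1 k (by rw [hk, sub_self])
  have hconst : ∀ w, h w = h z := fun w => by
    refine hh.apply_eq_apply_of_bounded ?_ w z
    refine isBounded_iff_forall_norm_le.2 ⟨(Real.exp S1 - 1) + (Real.exp S2 - 1), ?_⟩
    rintro _ ⟨w, rfl⟩
    exact hbd w
  have hz0 : h z = 0 := by
    rw [← norm_le_zero_iff]
    refine le_of_forall_pos_le_add fun η hη => ?_
    rw [zero_add]
    obtain ⟨y, hy1, hy2⟩ := ((imag a b ha hb hbpos (η / 2) (half_pos hη)).and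
      (imag c b hc hb hbpos (η / 2) (half_pos hη))).exists
    rw [← hconst (y * Complex.I), ← add_halves η]
    refine hnorm _ _ (fun h0 => ?_) hy1 _ hy2
    obtain ⟨k, hk⟩ := (Pr_zero b hb _).1 h0
    rw [mul_pow, Complex.I_sq] at hk
    have h5 : y ^ 2 * (-1) = b k ^ 2 := by exact_mod_cast hk
    nlinarith [sq_nonneg y, pow_pos (hbpos k) 2]
  have := hD z
  rw [hz0, mul_zero] at this
  exact sub_eq_zero.1 this

end PFC

/-- uniqueness step in Lemma 3.7. Sequences are indexed by `ℕ`,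
with index `k : ℕ` standing for the subscript `k + 1`; thus `π (k - 1/2)` becomes
`π (k + 1/2)`. -/
theorem product_functions_coincide
    (mus nus lam : ℕ → ℝ)
    (hmupos : ∀ k, 0 < mus k) (hnupos : ∀ k, 0 < nus k) (hlampos : ∀ n, 0 < lam n)
    (hmu : Summable (fun k : ℕ => (mus k - π * ((k : ℝ) + 1 / 2)) ^ 2))
    (hnu : Summable (fun k : ℕ => (nus k - π * ((k : ℝ) + 1 / 2)) ^ 2))
    (hlam : Summable (fun n : ℕ => (lam n - π * ((n : ℝ) + 1 / 2)) ^ 2))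
    (hmumono : StrictMono mus) (hnumono : StrictMono nus)
    (hlamdist : Function.Injective lam)
    (Φ Φt : ℂ → ℂ)
    (hΦ : ∀ z : ℂ, Tendsto
      (fun N : ℕ => ∏ k ∈ Finset.range N,
        (((mus k : ℝ) : ℂ) ^ 2 - z ^ 2) / ((π : ℂ) ^ 2 * ((k : ℂ) + 1 / 2) ^ 2))
      atTop (𝓝 (Φ z)))
    (hΦt : ∀ z : ℂ, Tendsto
      (fun N : ℕ => ∏ k ∈ Finset.range N,
        (((nus k : ℝ) : ℂ) ^ 2 - z ^ 2) / ((π : ℂ) ^ 2 * ((k : ℂ) + 1 / 2) ^ 2))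
      atTop (𝓝 (Φt z)))
    (heq : ∀ n : ℕ, Φ ((lam n : ℝ) : ℂ) = Φt ((lam n : ℝ) : ℂ)) :
    (∀ z : ℂ, Φ z = Φt z) ∧ ∀ k : ℕ, mus k = nus k := by
  have hmu' : Summable fun k => (mus k - PFC.P k) ^ 2 := hmu
  have hnu' : Summable fun k => (nus k - PFC.P k) ^ 2 := hnu
  have hlam' : Summable fun k => (lam k - PFC.P k) ^ 2 := hlam
  have e1 : ∀ z, Φ z = PFC.Pr mus z := fun z =>
    tendsto_nhds_unique (hΦ z) (PFC.Pr_tendsto mus hmu' z)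
  have e2 : ∀ z, Φt z = PFC.Pr nus z := fun z =>
    tendsto_nhds_unique (hΦt z) (PFC.Pr_tendsto nus hnu' z)
  have hmain : ∀ z, PFC.Pr mus z = PFC.Pr nus z :=
    PFC.main_eq mus nus lam hmu' hnu' hlam' hmupos hnupos hlampos hlamdist
      (fun n => by rw [← e1, ← e2]; exact heq n)
  refine ⟨fun z => by rw [e1, e2, hmain], ?_⟩
  have sub : ∀ a b : ℕ → ℝ, (Summable fun k => (a k - PFC.P k) ^ 2) →
      (Summable fun k => (b k - PFC.P k) ^ 2) → (∀ k, 0 < a k) → (∀ k, 0 < b k) →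
      (∀ z, PFC.Pr a z = PFC.Pr b z) → range a ⊆ range b := by
    rintro a b ha hb hap hbp h _ ⟨k, rfl⟩
    have h0 : PFC.Pr a (a k) = 0 := (PFC.Pr_zero a ha _).2 ⟨k, rfl⟩
    rw [h] at h0
    obtain ⟨j, hj⟩ := (PFC.Pr_zero b hb _).1 h0
    have hj' : a k ^ 2 = b j ^ 2 := by exact_mod_cast hj
    exact ⟨j, ((pow_left_inj₀ (hap k).le (hbp j).le two_ne_zero).1 hj').symm⟩
  have hr : range mus = range nus :=
    Subset.antisymm (sub mus nus hmu' hnu' hmupos hnupos hmain)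
      (sub nus mus hnu' hmu' hnupos hmupos fun z => (hmain z).symm)
  exact fun k => congrFun ((hmumono.range_inj hnumono).1 hr) k
end
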